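/- Let n ≥ 2, let K be a field, let G = C_{2n}(1,n) be the circulant graph on 2n vertices with connection set {1,n}, and let S = K[V(G)]. Then pdim(S/I(G)) = 2n − ⌈n/2⌉ if n ≡ 1 (mod 4), and pdim(S/I(G)) = 2n − ⌈(n−1)/2⌉ otherwise. -/

import Mathlib

open MvPolynomial

/-- The edge ideal of a simple graph `G`, inside `K[x_v : v ∈ V]`. -/
noncomputable def edgeIdeal (K : Type*) [Field K] {V : Type*} (G : SimpleGraph V) :
    Ideal (MvPolynomial V K) :=
  Ideal.span {m | ∃ i j : V, G.Adj i j ∧ m = X i * X j}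

/-- The graded maximal ideal of `K[x_v : v ∈ V]`. -/
noncomputable def maxIdeal (K : Type*) [Field K] (V : Type*) : Ideal (MvPolynomial V K) :=
  Ideal.span (Set.range (X : V → MvPolynomial V K))

/-- depth of `S/I` over `S = K[x_v]`: the supremum of lengths of regular sequences on `S/I`
consisting of elements of the graded maximal ideal. -/
noncomputable def depthQuot {K : Type*} [Field K] {V : Type*} (I : Ideal (MvPolynomial V K)) : ℕ :=
  sSup {n : ℕ | ∃ rs : List (MvPolynomial V K), rs.length = n ∧
    (∀ r ∈ rs, r ∈ maxIdeal K V) ∧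
    RingTheory.Sequence.IsRegular (MvPolynomial V K ⧸ I) rs}

/-- The Stanley space `u·K[Z]` inside `S/I`, as a `K`-subspace. -/
noncomputable def stanleySpace {K : Type*} [Field K] {V : Type*}
    (I : Ideal (MvPolynomial V K)) (u : V →₀ ℕ) (Z : Finset V) :
    Submodule K (MvPolynomial V K ⧸ I) :=
  Submodule.span K
    {x | ∃ a : V →₀ ℕ, a.support ⊆ Z ∧ x = Ideal.Quotient.mk I (monomial (u + a) (1 : K))}

/-- A Stanley decomposition of `S/I`: a finite family of Stanley spaces `u_j K[Z_j]`,
each of which is a free `K[Z_j]`-module (expressed by linear independence of the monomial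
spanning set), whose internal direct sum is all of `S/I`. -/
structure StanleyDecomposition {K : Type*} [Field K] {V : Type*}
    (I : Ideal (MvPolynomial V K)) : Type _ where
  m : ℕ
  u : Fin m → (V →₀ ℕ)
  Z : Fin m → Finset V
  free : ∀ j : Fin m, LinearIndependent K
    (fun a : {a : V →₀ ℕ // a.support ⊆ Z j} =>
      Ideal.Quotient.mk I (monomial (u j + (a : V →₀ ℕ)) (1 : K)))
  internal : DirectSum.IsInternal (fun j : Fin m => stanleySpace I (u j) (Z j))

/-- The Stanley depth of `S/I`. -/
noncomputable def sdepthQuot {K : Type*} [Field K] {V : Type*}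
    (I : Ideal (MvPolynomial V K)) : ℕ :=
  sSup {n : ℕ | ∃ D : StanleyDecomposition I, ∀ j, n ≤ (D.Z j).card}

/-- `pdimLE R n M`: the `R`-module `M` has projective dimension at most `n`,
i.e. it admits a projective resolution of length `n`. -/
def pdimLE (R : Type*) [CommRing R] :
    (n : ℕ) → (M : Type*) → [AddCommGroup M] → [Module R M] → Prop
  | 0, M, _, _ => Module.Projective R M
  | (n+1), M, _, _ => ∃ (P : Type _) (_ : AddCommGroup P) (_ : Module R P)
      (f : P →ₗ[R] M), Module.Projective R P ∧ Function.Surjective f ∧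
        pdimLE R n (LinearMap.ker f)

/-- The projective dimension of `S/I` over `S`: the length of a minimal (projective/free)
resolution, i.e. the least `n` such that `S/I` has a projective resolution of length `n`. -/
noncomputable def pdimQuot {K : Type*} [Field K] {V : Type*}
    (I : Ideal (MvPolynomial V K)) : ℕ :=
  sInf {n : ℕ | pdimLE (MvPolynomial V K) n (MvPolynomial V K ⧸ I)}

/-- The ladder graph `A n` on `2n` vertices: `inl i = x_{i+1}`, `inr i = y_{i+1}`. -/
def graphA (n : ℕ) : SimpleGraph (Fin n ⊕ Fin n) :=
  SimpleGraph.fromRel (fun a b =>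
    match a, b with
    | .inl i, .inl j => (i : ℕ) + 1 = j
    | .inr i, .inr j => (i : ℕ) + 1 = j
    | .inl i, .inr j => (i : ℕ) = (j : ℕ)
    | .inr _, .inl _ => False)

/-- The graph `B n`: the ladder `A n` with one extra vertex `y_{n+1}` and edge `{y_n, y_{n+1}}`.
Here `inl i = x_{i+1}` (`i < n`) and `inr i = y_{i+1}` (`i < n+1`). -/
def graphB (n : ℕ) : SimpleGraph (Fin n ⊕ Fin (n+1)) :=
  SimpleGraph.fromRel (fun a b =>
    match a, b with
    | .inl i, .inl j => (i : ℕ) + 1 = j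
    | .inr i, .inr j => (i : ℕ) + 1 = j
    | .inl i, .inr j => (i : ℕ) = (j : ℕ)
    | .inr _, .inl _ => False)

/-- The graph `C n`: the ladder `A n` with two extra vertices `y_{n+1}, y_{n+2}` and extra
edges `{y_n, y_{n+1}}` and `{y_1, y_{n+2}}`. Here `inl i = x_{i+1}` (`i < n`) and
`inr i = y_{i+1}` (`i < n+2`). -/
def graphC (n : ℕ) : SimpleGraph (Fin n ⊕ Fin (n+2)) :=
  SimpleGraph.fromRel (fun a b =>
    match a, b with
    | .inl i, .inl j => (i : ℕ) + 1 = j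
    | .inr i, .inr j => ((i : ℕ) + 1 = j ∧ (j : ℕ) ≤ n) ∨ ((i : ℕ) = 0 ∧ (j : ℕ) = n + 1)
    | .inl i, .inr j => (i : ℕ) = (j : ℕ)
    | .inr _, .inl _ => False)

/-- The graph `D n`: the ladder `A n` with two extra vertices `x_{n+1}, y_{n+1}` and extra
edges `{y_n, y_{n+1}}` and `{x_1, x_{n+1}}`. Here `inl i = x_{i+1}` and `inr i = y_{i+1}`
(`i < n+1`). -/
def graphD (n : ℕ) : SimpleGraph (Fin (n+1) ⊕ Fin (n+1)) :=
  SimpleGraph.fromRel (fun a b =>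
    match a, b with
    | .inl i, .inl j => ((i : ℕ) + 1 = j ∧ (j : ℕ) ≤ n - 1) ∨ ((i : ℕ) = 0 ∧ (j : ℕ) = n)
    | .inr i, .inr j => (i : ℕ) + 1 = j
    | .inl i, .inr j => (i : ℕ) = (j : ℕ) ∧ (i : ℕ) ≤ n - 1
    | .inr _, .inl _ => False)

/-- The circulant graph `C_q(s)` on vertex set `{x_1, …, x_q}` (realized as `Fin q`):
`x_i` and `x_j` are adjacent iff `|i - j| ∈ s` or `q - |i - j| ∈ s`. -/
def circulantGraph (q : ℕ) (s : Set ℕ) : SimpleGraph (Fin q) :=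
  SimpleGraph.fromRel (fun i j =>
    ((i : ℤ) - (j : ℤ)).natAbs ∈ s ∨ q - ((i : ℤ) - (j : ℤ)).natAbs ∈ s)



open CategoryTheory in
theorem pdimLE_iff_aux {R : Type u} [CommRing R] (n : ℕ) :
    ∀ (M : Type u) [AddCommGroup M] [Module R M],
    pdimLE R n M ↔ HasProjectiveDimensionLT (ModuleCat.of R M) (n+1) := by
  induction n with
  | zero =>
    intro M _ _
    rw [pdimLE, IsProjective.iff_projective]
    exact projective_iff_hasProjectiveDimensionLT_one
  | succ n ih =>
    intro M _ _
    constructor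
    · rintro ⟨P, _, _, f, hP, hf, hk⟩
      rw [ih] at hk
      have hS := LinearMap.shortExact_shortComplexKer hf
      refine hS.hasProjectiveDimensionLT_X₃ (n+1) hk ?_
      have : Projective (ModuleCat.of R P) := (IsProjective.iff_projective _).1 hP
      exact hasProjectiveDimensionLT_of_ge (ModuleCat.of R P) 1 _ (by omega)
    · intro h
      refine ⟨M →₀ R, inferInstance, inferInstance, Finsupp.linearCombination R id,
        inferInstance, Finsupp.linearCombination_id_surjective R M, ?_⟩
      rw [ih]
      have hS := LinearMap.shortExact_shortComplexKer
        (Finsupp.linearCombination_id_surjective R M)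
      refine hS.hasProjectiveDimensionLT_X₁ (n+1) ?_ h
      have : Projective (ModuleCat.of R (M →₀ R)) :=
        (IsProjective.iff_projective _).1 inferInstance
      exact hasProjectiveDimensionLT_of_ge (ModuleCat.of R (M →₀ R)) 1 _ (by omega)

open CategoryTheory in
theorem pdimLE_mono {R : Type u} [CommRing R] {n m : ℕ} (h : n ≤ m)
    (M : Type u) [AddCommGroup M] [Module R M] (hM : pdimLE R n M) : pdimLE R m M := by
  rw [pdimLE_iff_aux] at *
  exact hasProjectiveDimensionLT_of_ge _ (n+1) _ (by omega)

section SES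
variable {R : Type u} [CommRing R] {A B C : Type u} [AddCommGroup A] [AddCommGroup B]
  [AddCommGroup C] [Module R A] [Module R B] [Module R C] {f : A →ₗ[R] B} {g : B →ₗ[R] C}

open CategoryTheory in
theorem ses_shortExact (hf : Function.Injective f) (hg : Function.Surjective g)
    (h : Function.Exact f g) :
    (ModuleCat.shortComplexOfCompEqZero f g h.linearMap_comp_eq_zero).ShortExact :=
  ModuleCat.shortComplex_shortExact _ h hf hg

theorem pdimLE_mid (hf : Function.Injective f) (hg : Function.Surjective g)
    (h : Function.Exact f g) {p : ℕ} (hA : pdimLE R p A) (hC : pdimLE R p C) :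
    pdimLE R p B := by
  rw [pdimLE_iff_aux] at *
  exact (ses_shortExact hf hg h).hasProjectiveDimensionLT_X₂ (p+1) hA hC

theorem pdimLE_right (hf : Function.Injective f) (hg : Function.Surjective g)
    (h : Function.Exact f g) {p : ℕ} (hA : pdimLE R p A) (hB : pdimLE R (p+1) B) :
    pdimLE R (p+1) C := by
  rw [pdimLE_iff_aux] at *
  exact (ses_shortExact hf hg h).hasProjectiveDimensionLT_X₃ (p+1) hA hB
end SES

/-- `σ` is a face of the independence complex of the induced subgraph `G[R]`. -/
def IsFace {V : Type} (G : SimpleGraph V) (R σ : Finset V) : Prop :=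
  σ ⊆ R ∧ ∀ u ∈ σ, ∀ v ∈ σ, ¬ G.Adj u v

theorem IsFace.mono {V : Type} {G : SimpleGraph V} {R σ τ : Finset V} (h : IsFace G R τ)
    (hs : σ ⊆ τ) : IsFace G R σ :=
  ⟨hs.trans h.1, fun u hu v hv => h.2 u (hs hu) v (hs hv)⟩

/-- The Stanley-Reisner ideal of the independence complex of `G[R]`. -/
noncomputable def srIdeal (K : Type u) [Field K] {V : Type} (G : SimpleGraph V)
    (R : Finset V) : Ideal (MvPolynomial V K) where
  carrier := {f | ∀ m ∈ f.support, ¬ IsFace G R m.support}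
  add_mem' := by
    classical
    intro a b ha hb m hm
    rcases Finset.mem_union.1 (MvPolynomial.support_add hm) with h | h
    · exact ha m h
    · exact hb m h
  zero_mem' := by intro m hm; simp at hm
  smul_mem' := by
    classical
    intro c f hf m hm hF
    rw [smul_eq_mul] at hm
    obtain ⟨a, ha, b, hb, rfl⟩ := Finset.mem_add.1 (MvPolynomial.support_mul c f hm)
    refine hf b hb (hF.mono ?_)
    intro v hv
    simp only [Finsupp.mem_support_iff, Finsupp.add_apply] at hv ⊢
    omega

section
variable {K : Type u} [Field K] {V : Type} {G : SimpleGraph V} {R : Finset V}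

theorem mem_srIdeal {f : MvPolynomial V K} :
    f ∈ srIdeal K G R ↔ ∀ m ∈ f.support, ¬ IsFace G R m.support := Iff.rfl

theorem srIdeal_mono {R' : Finset V} (h : R' ⊆ R) : srIdeal K G R ≤ srIdeal K G R' :=
  fun _ hf m hm hF => hf m hm ⟨hF.1.trans h, hF.2⟩

theorem edgeIdeal_eq_srIdeal [Fintype V] :
    edgeIdeal K G = srIdeal K G Finset.univ := by
  classical
  have h1 : edgeIdeal K G = Ideal.span ((fun s => monomial s (1 : K)) ''
      {s | ∃ i j, G.Adj i j ∧ s = Finsupp.single i 1 + Finsupp.single j 1}) := by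
    unfold edgeIdeal
    congr 1
    ext m
    constructor
    · rintro ⟨i, j, h, rfl⟩
      exact ⟨_, ⟨i, j, h, rfl⟩, by simp [X, monomial_mul]⟩
    · rintro ⟨_, ⟨i, j, h, rfl⟩, rfl⟩
      exact ⟨i, j, h, by simp [X, monomial_mul]⟩
  rw [h1]
  ext f
  rw [mem_ideal_span_monomial_image, mem_srIdeal]
  refine forall₂_congr fun m hm => ?_
  constructor
  · rintro ⟨_, ⟨i, j, h, rfl⟩, hle⟩ hF
    refine hF.2 i ?_ j ?_ h
    · have := hle i
      simp only [Finsupp.mem_support_iff, Finsupp.add_apply, Finsupp.single_eq_same] at this ⊢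
      omega
    · have := hle j
      simp only [Finsupp.mem_support_iff, Finsupp.add_apply, Finsupp.single_eq_same] at this ⊢
      omega
  · intro hF
    simp only [IsFace, Finset.subset_univ, true_and, not_forall, not_not] at hF
    obtain ⟨i, hi, j, hj, h⟩ := hF
    refine ⟨_, ⟨i, j, h, rfl⟩, fun v => ?_⟩
    have hne := h.ne
    simp only [Finsupp.mem_support_iff] at hi hj
    simp only [Finsupp.add_apply, Finsupp.single_apply]
    split_ifs with h1 h2 h2
    · exact absurd (h1.trans h2.symm) hne
    · subst h1; omega
    · subst h2; omega
    · omega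

variable [DecidableEq V] [DecidableRel G.Adj]

theorem isFace_insert {v : V} (hv : v ∈ R) (σ : Finset V) :
    IsFace G R (insert v σ) ↔ IsFace G (R.filter (fun u => ¬ G.Adj v u)) σ := by
  constructor
  · rintro ⟨h1, h2⟩
    refine ⟨fun u hu => Finset.mem_filter.2 ⟨h1 (Finset.mem_insert_of_mem hu),
      h2 v (Finset.mem_insert_self _ _) u (Finset.mem_insert_of_mem hu)⟩, fun a ha b hb =>
      h2 a (Finset.mem_insert_of_mem ha) b (Finset.mem_insert_of_mem hb)⟩
  · rintro ⟨h1, h2⟩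
    have h3 : ∀ u ∈ σ, ¬ G.Adj v u := fun u hu => (Finset.mem_filter.1 (h1 hu)).2
    refine ⟨Finset.insert_subset hv (h1.trans (Finset.filter_subset _ _)), fun a ha b hb => ?_⟩
    rcases Finset.mem_insert.1 ha with h4 | h4 <;> rcases Finset.mem_insert.1 hb with h5 | h5
    · subst h4; subst h5; exact G.irrefl
    · subst h4; exact h3 b h5
    · subst h5; exact fun h => h3 a h4 h.symm
    · exact h2 a h4 b h5

theorem support_add_single (m : V →₀ ℕ) (v : V) :
    (Finsupp.single v 1 + m).support = insert v m.support := by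
  ext u
  simp only [Finsupp.mem_support_iff, Finsupp.add_apply, Finsupp.single_apply, Finset.mem_insert]
  split_ifs with h
  · subst h; simp
  · simp [Ne.symm h]

theorem X_mul_mem_srIdeal {v : V} (hv : v ∈ R) (f : MvPolynomial V K) :
    X v * f ∈ srIdeal K G R ↔ f ∈ srIdeal K G (R.filter (fun u => ¬ G.Adj v u)) := by
  rw [mem_srIdeal, mem_srIdeal, support_X_mul]
  constructor
  · intro h m hm hF
    refine h _ (Finset.mem_map_of_mem _ hm) ?_
    rw [addLeftEmbedding_apply, support_add_single, isFace_insert hv]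
    exact hF
  · intro h m hm hF
    obtain ⟨m, hm', rfl⟩ := Finset.mem_map.1 hm
    rw [addLeftEmbedding_apply, support_add_single, isFace_insert hv] at hF
    exact h m hm' hF

theorem X_mem_srIdeal_erase (v : V) : (X v : MvPolynomial V K) ∈ srIdeal K G (R.erase v) := by
  intro m hm hF
  rw [support_X, Finset.mem_singleton] at hm
  subst hm
  have := hF.1 (show v ∈ _ by simp)
  simp at this

theorem exists_of_mem_srIdeal_erase {v : V} {f : MvPolynomial V K}
    (hf : f ∈ srIdeal K G (R.erase v)) : ∃ q, f - X v * q ∈ srIdeal K G R := by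
  refine ⟨f.divMonomial (Finsupp.single v 1), ?_⟩
  have h := divMonomial_add_modMonomial_single f v
  have h2 : f - X v * f.divMonomial (Finsupp.single v 1) = f.modMonomial (Finsupp.single v 1) := by
    rw [sub_eq_iff_eq_add]; rw [add_comm]; exact h.symm
  rw [h2]
  intro m hm hF
  rw [mem_support_iff] at hm
  by_cases hle : Finsupp.single v 1 ≤ m
  · exact hm (coeff_modMonomial_of_le _ hle)
  · rw [coeff_modMonomial_of_not_le _ hle] at hm
    refine hf m (mem_support_iff.2 hm) ⟨fun u hu => Finset.mem_erase.2 ⟨?_, hF.1 hu⟩, hF.2⟩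
    rintro rfl
    apply hle
    rw [Finsupp.single_le_iff]
    rw [Finsupp.mem_support_iff] at hu
    omega

/-- The short exact sequence `0 → S/(J : x_v) → S/J → S/(J, x_v) → 0`. -/
theorem srIdeal_ses {v : V} (hv : v ∈ R) :
    ∃ (f : (MvPolynomial V K ⧸ srIdeal K G (R.filter (fun u => ¬ G.Adj v u)))
        →ₗ[MvPolynomial V K] (MvPolynomial V K ⧸ srIdeal K G R))
      (g : (MvPolynomial V K ⧸ srIdeal K G R) →ₗ[MvPolynomial V K]
        (MvPolynomial V K ⧸ srIdeal K G (R.erase v))),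
      Function.Injective f ∧ Function.Surjective g ∧ Function.Exact f g := by
  have hle := srIdeal_mono (K := K) (G := G) (Finset.erase_subset v R)
  have hmap : srIdeal K G (R.filter (fun u => ¬ G.Adj v u)) ≤
      Submodule.comap (LinearMap.mulLeft (MvPolynomial V K) (X v)) (srIdeal K G R) :=
    fun f hf => (X_mul_mem_srIdeal hv f).2 hf
  refine ⟨Submodule.mapQ _ _ (LinearMap.mulLeft (MvPolynomial V K) (X v)) hmap, Submodule.factor hle, ?_, ?_, ?_⟩
  · rw [injective_iff_map_eq_zero]
    intro a ha
    obtain ⟨a, rfl⟩ := Submodule.Quotient.mk_surjective _ a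
    rw [Submodule.mapQ_apply, Submodule.Quotient.mk_eq_zero] at ha
    rw [Submodule.Quotient.mk_eq_zero]
    exact (X_mul_mem_srIdeal hv a).1 ha
  · exact Submodule.factor_surjective hle
  · intro b
    obtain ⟨b, rfl⟩ := Submodule.Quotient.mk_surjective _ b
    constructor
    · intro hb
      have hb' : b ∈ srIdeal K G (R.erase v) := by
        rw [← Submodule.Quotient.mk_eq_zero]; exact hb
      obtain ⟨q, hq⟩ := exists_of_mem_srIdeal_erase hb'
      refine ⟨Submodule.Quotient.mk q, ?_⟩
      rw [Submodule.mapQ_apply, eq_comm, Submodule.Quotient.eq]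
      exact hq
    · rintro ⟨a, ha⟩
      obtain ⟨a, rfl⟩ := Submodule.Quotient.mk_surjective _ a
      rw [← ha, Submodule.mapQ_apply]
      have : X v * a ∈ srIdeal K G (R.erase v) := Ideal.mul_mem_right _ _ (X_mem_srIdeal_erase v)
      exact (Submodule.Quotient.mk_eq_zero _).2 this

theorem pdim_le_of_edgeless [Fintype V] (hR : ∀ u v, ¬ G.Adj u v) (p : ℕ)
    (hp : p + R.card = Fintype.card V) :
    pdimLE (MvPolynomial V K) p (MvPolynomial V K ⧸ srIdeal K G R) := by
  induction p generalizing R with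
  | zero =>
    have hU : R = Finset.univ := Finset.eq_univ_of_card _ (by omega)
    have hb : srIdeal K G R = ⊥ := by
      rw [eq_bot_iff]
      intro f hf
      rw [Submodule.mem_bot, ← support_eq_empty, Finset.eq_empty_iff_forall_notMem]
      intro m hm
      exact hf m hm ⟨by simp [hU], fun u _ v _ => hR u v⟩
    rw [pdimLE]
    exact Module.Projective.of_equiv (Submodule.quotEquivOfEqBot _ hb).symm
  | succ p ih =>
    have : ∃ v, v ∉ R := by
      by_contra! h
      have : R = Finset.univ := Finset.eq_univ_of_forall h
      rw [this, Finset.card_univ] at hp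
      omega
    obtain ⟨v, hv⟩ := this
    have h := ih (R := insert v R) (by rw [Finset.card_insert_of_notMem hv]; omega)
    obtain ⟨f, g, h1, h2, h3⟩ := srIdeal_ses (K := K) (G := G) (Finset.mem_insert_self v R)
    have e : (insert v R).filter (fun u => ¬ G.Adj v u) = insert v R := by
      rw [Finset.filter_true_of_mem]; exact fun u _ => hR v u
    have e2 : (insert v R).erase v = R := Finset.erase_insert hv
    have h4 := pdimLE_right h1 h2 h3 (by rw [e]; exact h) (pdimLE_mono (Nat.le_succ p) _ h)
    rw [e2] at h4
    exact h4

theorem pdim_le_of_indep [Fintype V] (hR : ∀ u ∈ R, ∀ v ∈ R, ¬ G.Adj u v) (p : ℕ)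
    (hp : p + R.card = Fintype.card V) :
    pdimLE (MvPolynomial V K) p (MvPolynomial V K ⧸ srIdeal K G R) := by
  have h : srIdeal K G R = srIdeal K (⊥ : SimpleGraph V) R := by
    ext f
    rw [mem_srIdeal, mem_srIdeal]
    refine forall₂_congr fun m hm => not_congr ?_
    exact ⟨fun h => ⟨h.1, by simp⟩, fun h => ⟨h.1, fun u hu v hv => hR u (h.1 hu) v (h.1 hv)⟩⟩
  rw [h]
  exact pdim_le_of_edgeless (by simp) p hp

/-- A vertex-picking game bounding the projective dimension from above. -/
inductive Game (G : SimpleGraph V) [DecidableRel G.Adj] : Finset V → ℕ → Prop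
  | done (R : Finset V) (d : ℕ) : (∀ u ∈ R, ∀ v ∈ R, ¬ G.Adj u v) → d ≤ R.card → Game G R d
  | step (R : Finset V) (d : ℕ) (v : V) : v ∈ R → Game G (R.erase v) d →
      Game G (R.filter (fun u => ¬ G.Adj v u)) d → Game G R d

theorem pdim_le_of_game [Fintype V] {d : ℕ} (h : Game G R d) (p : ℕ)
    (hp : Fintype.card V ≤ p + d) :
    pdimLE (MvPolynomial V K) p (MvPolynomial V K ⧸ srIdeal K G R) := by
  induction h with
  | done R d h1 h2 =>
    have h3 := Finset.card_le_univ R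
    exact pdimLE_mono (n := Fintype.card V - R.card) (by omega) _
      (pdim_le_of_indep h1 _ (by omega))
  | step R d v hv _ _ ih1 ih2 =>
    obtain ⟨f, g, h1, h2, h3⟩ := srIdeal_ses (K := K) (G := G) hv
    exact pdimLE_mid h1 h2 h3 (ih2 hp) (ih1 hp)
end

section Koszul
variable {V : Type} [LinearOrder V]

/-- Koszul sign. -/
def ksgn (v : V) (τ : Finset V) : ℤ := (-1) ^ (τ.filter (· < v)).card

theorem ksgn_mul_self (v : V) (τ : Finset V) : ksgn v τ * ksgn v τ = 1 := by
  unfold ksgn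
  rw [← mul_pow]; simp

theorem ksgn_erase_of_le {v w : V} (h : v ≤ w) (τ : Finset V) :
    ksgn v (τ.erase w) = ksgn v τ := by
  unfold ksgn
  congr 2
  ext u
  simp only [Finset.mem_filter, Finset.mem_erase]
  constructor
  · rintro ⟨⟨_, h1⟩, h2⟩; exact ⟨h1, h2⟩
  · rintro ⟨h1, h2⟩; exact ⟨⟨(h2.trans_le h).ne, h1⟩, h2⟩

theorem ksgn_insert_of_le {v w : V} (h : v ≤ w) (τ : Finset V) :
    ksgn v (insert w τ) = ksgn v τ := by
  unfold ksgn
  congr 2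
  ext u
  simp only [Finset.mem_filter, Finset.mem_insert]
  constructor
  · rintro ⟨rfl | h1, h2⟩
    · exact absurd h2 (not_lt.2 h)
    · exact ⟨h1, h2⟩
  · rintro ⟨h1, h2⟩; exact ⟨Or.inr h1, h2⟩

theorem ksgn_erase_of_lt {v w : V} (h : w < v) {τ : Finset V} (hw : w ∈ τ) :
    ksgn v (τ.erase w) = - ksgn v τ := by
  unfold ksgn
  have : τ.filter (· < v) = insert w ((τ.erase w).filter (· < v)) := by
    ext u
    simp only [Finset.mem_filter, Finset.mem_erase, Finset.mem_insert]
    by_cases hu : u = w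
    · subst hu; simp [hw, h]
    · simp [hu]
  rw [this, Finset.card_insert_of_notMem (by simp), pow_succ]
  ring

theorem ksgn_anti {v w : V} (h : v ≠ w) {τ : Finset V} (hv : v ∈ τ) (hw : w ∈ τ) :
    ksgn v τ * ksgn w (τ.erase v) = - (ksgn w τ * ksgn v (τ.erase w)) := by
  rcases lt_or_gt_of_ne h with h | h
  · rw [ksgn_erase_of_lt h hv, ksgn_erase_of_le h.le]; ring
  · rw [ksgn_erase_of_le h.le, ksgn_erase_of_lt h hw]; ring

variable {A : Type*} [CommRing A] (x : V → A) {M N : Type*} [AddCommGroup M] [Module A M]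
  [AddCommGroup N] [Module A N]

/-- Koszul (cochain) differential. -/
def kd (m : Finset V → M) (τ : Finset V) : M :=
  ∑ v ∈ τ, ksgn v τ • x v • m (τ.erase v)

variable {x}

theorem kd_congr {m m' : Finset V → M} {τ : Finset V}
    (h : ∀ v ∈ τ, m (τ.erase v) = m' (τ.erase v)) : kd x m τ = kd x m' τ :=
  Finset.sum_congr rfl fun v hv => by rw [h v hv]

theorem kd_map (f : M →ₗ[A] N) (m : Finset V → M) (τ : Finset V) :
    f (kd x m τ) = kd x (fun σ => f (m σ)) τ := by
  simp [kd, map_sum]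

theorem kd_sub (m m' : Finset V → M) (τ : Finset V) :
    kd x (fun σ => m σ - m' σ) τ = kd x m τ - kd x m' τ := by
  simp [kd, smul_sub]

theorem kd_kd (m : Finset V → M) (τ : Finset V) : kd x (kd x m) τ = 0 := by
  unfold kd
  simp only [Finset.smul_sum]
  rw [Finset.sum_sigma']
  refine Finset.sum_involution (fun p _ => ⟨p.2, p.1⟩) ?_ ?_ ?_ ?_
  · rintro ⟨v, w⟩ h
    simp only [Finset.mem_sigma, Finset.mem_erase] at h
    obtain ⟨hv, hne, hw⟩ := h
    have e : (τ.erase w).erase v = (τ.erase v).erase w := Finset.erase_right_comm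
    simp only [e]
    rw [smul_comm (x v) (ksgn w (τ.erase v)), smul_comm (x w) (ksgn v (τ.erase w)),
      smul_smul (ksgn v τ) (ksgn w (τ.erase v)), smul_smul (ksgn w τ) (ksgn v (τ.erase w)), ksgn_anti hne.symm hv hw, smul_comm (x v) (x w), neg_smul, neg_add_cancel]
  · rintro ⟨v, w⟩ h _ h2
    simp only [Finset.mem_sigma, Finset.mem_erase] at h
    simp only [Sigma.mk.injEq, heq_eq_eq] at h2
    exact h.2.1 h2.1
  · rintro ⟨v, w⟩ h
    simp only [Finset.mem_sigma, Finset.mem_erase] at h ⊢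
    exact ⟨h.2.2, h.2.1.symm, h.1⟩
  · rintro ⟨v, w⟩ h; rfl

theorem kd_insert_max {w : V} {τ : Finset V} (hw : ∀ v ∈ τ, v < w) (m : Finset V → M) :
    kd x m (insert w τ) = kd x (fun σ => m (insert w σ)) τ + ksgn w τ • x w • m τ := by
  have hwn : w ∉ τ := fun h => lt_irrefl _ (hw w h)
  unfold kd
  rw [Finset.sum_insert hwn, add_comm, Finset.erase_insert hwn, ksgn_insert_of_le le_rfl]
  congr 1
  refine Finset.sum_congr rfl fun v hv => ?_
  rw [ksgn_insert_of_le (hw v hv).le, Finset.erase_insert_of_ne (hw v hv).ne']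

theorem kd_mem_ideal {K : Type*} [Field K] (m : Finset V → MvPolynomial V K) (τ : Finset V) :
    kd (X : V → MvPolynomial V K) m τ ∈ Ideal.span ((X : V → MvPolynomial V K) '' τ) := by
  unfold kd
  refine Ideal.sum_mem _ fun v hv => ?_
  refine zsmul_mem ?_ _
  exact Ideal.mul_mem_right _ _ (Ideal.subset_span ⟨v, hv, rfl⟩)

theorem X_mul_mem_span {K : Type*} [Field K] {U : Finset V} {w : V} (hw : w ∉ U)
    {f : MvPolynomial V K} (h : X w * f ∈ Ideal.span ((X : V → MvPolynomial V K) '' U)) :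
    f ∈ Ideal.span ((X : V → MvPolynomial V K) '' U) := by
  rw [mem_ideal_span_X_image] at h ⊢
  intro m hm
  obtain ⟨i, hi, h2⟩ := h (Finsupp.single w 1 + m) (by
    rw [support_X_mul]; exact Finset.mem_map_of_mem _ hm)
  refine ⟨i, hi, ?_⟩
  have : w ≠ i := by rintro rfl; exact hw hi
  simpa [Finsupp.single_apply, this] using h2

theorem koszul_exact {K : Type*} [Field K] (U : Finset V) :
    ∀ m : Finset V → MvPolynomial V K, (∀ τ ⊆ U, kd (X : V → MvPolynomial V K) m τ = 0) →
      m U ∈ Ideal.span ((X : V → MvPolynomial V K) '' U) →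
      ∃ n : Finset V → MvPolynomial V K, ∀ σ ⊆ U, m σ = kd (X : V → MvPolynomial V K) n σ := by
  induction U using Finset.induction_on_max with
  | empty =>
    intro m _ h
    refine ⟨0, fun σ hσ => ?_⟩
    rw [Finset.subset_empty.1 hσ]
    simpa [kd] using h
  | insert w U hw ih =>
    intro m hm hU
    have hwn : w ∉ U := fun h => lt_irrefl _ (hw w h)
    have hsub : ∀ {τ : Finset V}, τ ⊆ U → ∀ v ∈ τ, v < w := fun h v hv => hw v (h hv)
    have hins : ∀ τ ⊆ U, kd (X : V → MvPolynomial V K) (fun σ => m (insert w σ)) τ + ksgn w τ • (X w : MvPolynomial V K) • m τ = 0 := by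
      intro τ hτ
      rw [← kd_insert_max (hsub hτ)]
      exact hm _ (Finset.insert_subset_insert _ hτ)
    have hmU : m U ∈ Ideal.span ((X : V → MvPolynomial V K) '' U) := by
      apply X_mul_mem_span hwn
      have h1 := hins U subset_rfl
      have h2 := kd_mem_ideal (fun σ => m (insert w σ)) U
      have h3 : ksgn w U • (X w * m U) = - kd (X : V → MvPolynomial V K) (fun σ => m (insert w σ)) U := by
        rw [eq_neg_iff_add_eq_zero, add_comm]; exact h1
      have h4 : X w * m U = ksgn w U • (- kd (X : V → MvPolynomial V K) (fun σ => m (insert w σ)) U) := by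
        rw [← h3, smul_smul, ksgn_mul_self, one_smul]
      rw [h4]
      exact zsmul_mem (neg_mem h2) _
    obtain ⟨n0, hn0⟩ := ih m (fun τ hτ => hm τ (hτ.trans (Finset.subset_insert _ _))) hmU
    rw [Finset.coe_insert, Set.image_insert_eq, Ideal.mem_span_insert] at hU
    obtain ⟨c, r, hr, hcr⟩ := hU
    let n : Finset V → MvPolynomial V K := Function.update n0 U (ksgn w U • c)
    have hn : ∀ σ ⊆ U, m σ = kd (X : V → MvPolynomial V K) n σ := by
      intro σ hσ
      rw [hn0 σ hσ]
      refine kd_congr fun v hv => ?_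
      have : σ.erase v ≠ U := by
        rintro rfl
        exact (Finset.notMem_erase v σ) (hσ hv)
      simp [n, this]
    obtain ⟨n', hn'⟩ := ih (fun σ => m (insert w σ) - ksgn w σ • (X w : MvPolynomial V K) • n σ) (by
      intro τ hτ
      rw [kd_sub]
      have : kd (X : V → MvPolynomial V K) (fun σ => ksgn w σ • (X w : MvPolynomial V K) • n σ) τ = - (ksgn w τ • (X w : MvPolynomial V K) • m τ) := by
        rw [hn τ hτ]
        unfold kd
        simp only [Finset.smul_sum]
        rw [← Finset.sum_neg_distrib]
        refine Finset.sum_congr rfl fun v hv => ?_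
        rw [ksgn_erase_of_lt (hsub hτ v hv) hv]
        simp only [smul_eq_mul, zsmul_eq_mul]
        push_cast
        ring
      rw [this, sub_neg_eq_add]
      exact hins τ hτ) (by
      have : m (insert w U) - ksgn w U • (X w : MvPolynomial V K) • n U = r := by
        simp only [n, Function.update_self]
        rw [smul_comm (X w) (ksgn w U) c, smul_smul, ksgn_mul_self, hcr]
        simp only [smul_eq_mul, one_smul]
        ring
      rw [this]; exact hr)
    refine ⟨fun σ => if w ∈ σ then n' (σ.erase w) else n σ, fun σ hσ => ?_⟩
    by_cases hwσ : w ∈ σ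
    · obtain ⟨τ, hτn, rfl⟩ : ∃ τ, w ∉ τ ∧ σ = insert w τ :=
        ⟨σ.erase w, Finset.notMem_erase _ _, (Finset.insert_erase hwσ).symm⟩
      have hτ : τ ⊆ U := by
        intro v hv
        rcases Finset.mem_insert.1 (hσ (Finset.mem_insert_of_mem hv)) with rfl | h
        · exact absurd hv hτn
        · exact h
      rw [kd_insert_max (hsub hτ)]
      have h1 := hn' τ hτ
      rw [if_neg hτn]
      have h2 : kd (X : V → MvPolynomial V K) (fun σ => if w ∈ insert w σ then n' ((insert w σ).erase w) else
          n (insert w σ)) τ = kd (X : V → MvPolynomial V K) n' τ := by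
        refine kd_congr fun v hv => ?_
        rw [if_pos (Finset.mem_insert_self _ _), Finset.erase_insert]
        exact fun h => hτn (Finset.mem_of_mem_erase h)
      rw [h2, ← h1]
      simp
    · have hσ' : σ ⊆ U := by
        intro v hv
        rcases Finset.mem_insert.1 (hσ hv) with rfl | h
        · exact absurd hv hwσ
        · exact h
      rw [hn σ hσ']
      refine kd_congr fun v hv => ?_
      rw [if_neg]
      exact fun h => hwσ (Finset.mem_of_mem_erase h)

theorem koszul_projective {K : Type*} [Field K] (M : Type*) [AddCommGroup M]
    [Module (MvPolynomial V K) M] [hP : Module.Projective (MvPolynomial V K) M]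
    (U : Finset V) (m : Finset V → M) (hU : m U = 0)
    (hm : ∀ τ ⊆ U, kd (X : V → MvPolynomial V K) m τ = 0) :
    ∃ n : Finset V → M, ∀ σ ⊆ U, m σ = kd (X : V → MvPolynomial V K) n σ := by
  classical
  obtain ⟨s, hs⟩ := hP.out
  have key : ∀ p : M, ∃ n : Finset V → MvPolynomial V K, ∀ σ ⊆ U, s (m σ) p = kd (X : V → MvPolynomial V K) n σ := by
    intro p
    refine koszul_exact U (fun σ => s (m σ) p) (fun τ hτ => ?_) (by simp [hU])
    have := kd_map (x := (X : V → MvPolynomial V K)) ((Finsupp.lapply p).comp s) m τ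
    simp only [LinearMap.comp_apply, Finsupp.lapply_apply] at this
    rw [← this, hm τ hτ]; simp
  choose n hn using key
  let T : Finset M := U.powerset.biUnion (fun σ => (s (m σ)).support)
  refine ⟨fun σ => ∑ p ∈ T, n p σ • p, fun σ hσ => ?_⟩
  have h1 : m σ = ∑ p ∈ T, (s (m σ) p) • p := by
    conv_lhs => rw [← hs (m σ)]
    rw [Finsupp.linearCombination_apply, Finsupp.sum_of_support_subset (s := T)]
    · rfl
    · exact Finset.subset_biUnion_of_mem (fun σ => (s (m σ)).support) (Finset.mem_powerset.2 hσ)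
    · simp
  rw [h1]
  unfold kd
  simp only [Finset.smul_sum]
  rw [Finset.sum_comm]
  refine Finset.sum_congr rfl fun p _ => ?_
  rw [hn p σ hσ]
  unfold kd
  rw [Finset.sum_smul]
  refine Finset.sum_congr rfl fun v _ => ?_
  rw [smul_assoc, smul_assoc]

theorem kd_homog {m : Finset V → M} {i : ℕ} (h : ∀ σ, m σ ≠ 0 → σ.card = i) (τ : Finset V)
    (hτ : kd x m τ ≠ 0) : τ.card = i + 1 := by
  obtain ⟨v, hv, h1⟩ := Finset.exists_ne_zero_of_sum_ne_zero hτ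
  have : m (τ.erase v) ≠ 0 := by
    intro h0; apply h1; simp [h0]
  rw [← h _ this, Finset.card_erase_add_one hv]

theorem koszul_vanish {K : Type u} [Field K] (q : ℕ) :
    ∀ (M : Type u) [AddCommGroup M] [Module (MvPolynomial V K) M],
    pdimLE (MvPolynomial V K) q M → ∀ (U : Finset V) (i : ℕ) (m : Finset V → M),
    (∀ σ, m σ ≠ 0 → σ.card = i) → i + q < U.card →
    (∀ τ ⊆ U, kd (X : V → MvPolynomial V K) m τ = 0) →
    ∃ n : Finset V → M, ∀ σ ⊆ U, m σ = kd (X : V → MvPolynomial V K) n σ := by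
  classical
  have base : ∀ (M : Type u) [AddCommGroup M] [Module (MvPolynomial V K) M],
    Module.Projective (MvPolynomial V K) M → ∀ (U : Finset V) (i : ℕ) (m : Finset V → M),
    (∀ σ, m σ ≠ 0 → σ.card = i) → i < U.card →
    (∀ τ ⊆ U, kd (X : V → MvPolynomial V K) m τ = 0) →
    ∃ n : Finset V → M, ∀ σ ⊆ U, m σ = kd (X : V → MvPolynomial V K) n σ := by
    intro M _ _ hP U i m h1 h2 h3
    refine koszul_projective M U m ?_ h3
    by_contra h
    have := h1 U h
    omega
  induction q with
  | zero =>
    intro M _ _ hM U i m h1 h2 h3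
    exact base M hM U i m h1 (by omega) h3
  | succ q ih =>
    intro M _ _ hM U i m h1 h2 h3
    obtain ⟨P, _, _, f, hP, hf, hk⟩ := hM
    choose g hg using hf
    let mt : Finset V → P := fun σ => if m σ = 0 then 0 else g (m σ)
    have hmt : ∀ σ, f (mt σ) = m σ := by
      intro σ
      simp only [mt]
      split_ifs with h
      · rw [map_zero, h]
      · exact hg _
    have hmt1 : ∀ σ, mt σ ≠ 0 → σ.card = i := by
      intro σ hσ
      refine h1 σ fun h => hσ ?_
      simp [mt, h]
    have hker : ∀ τ ⊆ U, kd (X : V → MvPolynomial V K) mt τ ∈ LinearMap.ker f := by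
      intro τ hτ
      rw [LinearMap.mem_ker, kd_map]
      simp only [hmt]
      exact h3 τ hτ
    let l : Finset V → LinearMap.ker f := fun τ => if h : τ ⊆ U then
      ⟨kd (X : V → MvPolynomial V K) mt τ, hker τ h⟩ else 0
    have hl : ∀ τ ⊆ U, (l τ : P) = kd (X : V → MvPolynomial V K) mt τ := by
      intro τ hτ
      simp [l, hτ]
    obtain ⟨n1, hn1⟩ := ih (LinearMap.ker f) hk U (i+1) l (by
      intro τ hτ
      by_cases h : τ ⊆ U
      · refine kd_homog (x := (X : V → MvPolynomial V K)) hmt1 τ ?_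
        rw [← hl τ h]
        simpa using hτ
      · simp [l, h] at hτ) (by omega) (by
      intro τ hτ
      have h4 : ((kd (X : V → MvPolynomial V K) l τ : LinearMap.ker f) : P) = 0 := by
        have := kd_map (x := (X : V → MvPolynomial V K)) (LinearMap.ker f).subtype l τ
        rw [Submodule.subtype_apply] at this
        rw [this, ← kd_kd (x := (X : V → MvPolynomial V K)) mt τ]
        refine kd_congr fun v hv => ?_
        exact hl _ ((Finset.erase_subset _ _).trans hτ)
      exact_mod_cast h4)
    let n2 : Finset V → P := fun σ => if σ.card = i then (n1 σ : P) else 0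
    have hn2 : ∀ σ, f (n2 σ) = 0 := by
      intro σ
      simp only [n2]
      split_ifs
      · exact (n1 σ).2
      · exact map_zero f
    have hn2' : ∀ τ ⊆ U, kd (X : V → MvPolynomial V K) n2 τ =
        kd (X : V → MvPolynomial V K) mt τ := by
      intro τ hτ
      by_cases hc : τ.card = i + 1
      · rw [← hl τ hτ, hn1 τ hτ]
        have := kd_map (x := (X : V → MvPolynomial V K)) (LinearMap.ker f).subtype n1 τ
        rw [Submodule.subtype_apply] at this
        rw [this]
        refine kd_congr fun v hv => ?_
        have : (τ.erase v).card = i := by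
          rw [Finset.card_erase_of_mem hv]; omega
        simp [n2, this]
      · have e1 : kd (X : V → MvPolynomial V K) n2 τ = 0 := by
          by_contra h
          exact hc (kd_homog (i := i) (fun σ hσ => by
            by_contra h'; exact hσ (by simp [n2, h'])) τ h)
        have e2 : kd (X : V → MvPolynomial V K) mt τ = 0 := by
          by_contra h
          exact hc (kd_homog hmt1 τ h)
        rw [e1, e2]
    obtain ⟨n3, hn3⟩ := base P hP U i (fun σ => mt σ - n2 σ) (by
      intro σ hσ
      by_contra h
      apply hσ
      have : mt σ = 0 := by
        by_contra h'; exact h (hmt1 σ h')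
      simp [this, n2, h]) (by omega) (by
      intro τ hτ
      rw [kd_sub, hn2' τ hτ, sub_self])
    refine ⟨fun σ => f (n3 σ), fun σ hσ => ?_⟩
    rw [← kd_map, ← hn3 σ hσ, map_sub, hmt, hn2, sub_zero]
end Koszul

section Hochster
variable {K : Type u} [Field K] {V : Type} [LinearOrder V] {G : SimpleGraph V} {R : Finset V}

/-- Indicator exponent vector. -/
noncomputable def indv (σ : Finset V) : V →₀ ℕ := ∑ v ∈ σ, Finsupp.single v 1

theorem indv_apply (σ : Finset V) (u : V) : indv σ u = if u ∈ σ then 1 else 0 := by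
  unfold indv
  rw [Finsupp.finsetSum_apply]
  simp [Finsupp.single_apply]

theorem indv_support (σ : Finset V) : (indv σ).support = σ := by
  ext u
  simp [indv_apply]

theorem indv_erase {v : V} {τ : Finset V} (hv : v ∈ τ) :
    Finsupp.single v 1 + indv (τ.erase v) = indv τ := by
  unfold indv
  rw [Finset.add_sum_erase τ (fun v => Finsupp.single v 1) hv]

theorem indv_insert {v : V} {τ : Finset V} (hv : v ∉ τ) :
    Finsupp.single v 1 + indv τ = indv (insert v τ) := by
  unfold indv
  rw [Finset.sum_insert hv]

theorem monomial_mem_srIdeal {s : V →₀ ℕ} (hs : ¬ IsFace G R s.support) (c : K) :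
    monomial s c ∈ srIdeal K G R := by
  classical
  intro m hm
  have := support_monomial_subset hm
  rw [Finset.mem_singleton] at this
  rw [this]; exact hs

theorem coeff_eq_zero_of_mem {f : MvPolynomial V K} (hf : f ∈ srIdeal K G R) {s : V →₀ ℕ}
    (hs : IsFace G R s.support) : coeff s f = 0 := by
  by_contra h
  exact hf s (mem_support_iff.2 h) hs

theorem hochster [Fintype V] {q : ℕ}
    (h : pdimLE (MvPolynomial V K) q (MvPolynomial V K ⧸ srIdeal K G R)) {i : ℕ}
    (hi : i + q < Fintype.card V) (c : Finset V → K) (hc : ∀ σ, c σ ≠ 0 → σ.card = i)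
    (hcoc : ∀ τ, IsFace G R τ → kd (fun _ => (1 : K)) c τ = 0) :
    ∃ a : Finset V → K, ∀ σ, IsFace G R σ → c σ = kd (fun _ => (1 : K)) a σ := by
  obtain ⟨n, hn⟩ := koszul_vanish q _ h Finset.univ i
    (fun σ => Ideal.Quotient.mk (srIdeal K G R) (monomial (indv σ) (c σ))) (by
      intro σ hσ
      refine hc σ fun h0 => hσ ?_
      rw [h0]; simp) (by simpa using hi) (by
      intro τ _
      have e : kd (X : V → MvPolynomial V K)
          (fun σ => Ideal.Quotient.mk (srIdeal K G R) (monomial (indv σ) (c σ))) τ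
          = Ideal.Quotient.mk (srIdeal K G R)
            (monomial (indv τ) (kd (fun _ => (1 : K)) c τ)) := by
        unfold kd
        rw [map_sum, map_sum]
        refine Finset.sum_congr rfl fun v hv => ?_
        rw [map_zsmul, map_zsmul]
        congr 1
        rw [one_smul, ← indv_erase hv, show monomial (Finsupp.single v 1 + indv (τ.erase v))
          (c (τ.erase v)) = X v * monomial (indv (τ.erase v)) (c (τ.erase v)) by
            rw [X, monomial_mul, one_mul]]
        rfl
      rw [e]
      by_cases hF : IsFace G R τ
      · rw [hcoc τ hF]; simp
      · rw [Ideal.Quotient.eq_zero_iff_mem]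
        exact monomial_mem_srIdeal (by rwa [indv_support]) _)
  choose n' hn' using fun σ => Ideal.Quotient.mk_surjective (n σ)
  refine ⟨fun ρ => coeff (indv ρ) (n' ρ), fun σ hσ => ?_⟩
  have h1 := hn σ (Finset.subset_univ _)
  have h2 : kd (X : V → MvPolynomial V K) n σ = Ideal.Quotient.mk (srIdeal K G R)
      (kd (X : V → MvPolynomial V K) n' σ) := by
    have := kd_map (x := (X : V → MvPolynomial V K))
      (Submodule.mkQ (srIdeal K G R)) n' σ
    rw [show Ideal.Quotient.mk (srIdeal K G R) (kd (X : V → MvPolynomial V K) n' σ)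
      = (Submodule.mkQ (srIdeal K G R)) (kd (X : V → MvPolynomial V K) n' σ) from rfl, this]
    refine kd_congr fun v _ => ?_
    exact (hn' _).symm
  rw [h2, Ideal.Quotient.eq] at h1
  have h3 := coeff_eq_zero_of_mem h1 (s := indv σ) (by rwa [indv_support])
  rw [coeff_sub, coeff_monomial, if_pos rfl, sub_eq_zero] at h3
  rw [h3]
  unfold kd
  rw [coeff_sum]
  refine Finset.sum_congr rfl fun v hv => ?_
  rw [one_smul, ← lcoeff_apply, map_zsmul, lcoeff_apply, ← indv_erase hv, smul_eq_mul, coeff_X_mul]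

theorem socle_bound [Fintype V] {q : ℕ}
    (h : pdimLE (MvPolynomial V K) q (MvPolynomial V K ⧸ srIdeal K G Finset.univ))
    (A : Finset V) (hA : IsFace G Finset.univ A)
    (hmax : ∀ v, v ∉ A → ∃ u ∈ A, G.Adj u v) : Fintype.card V ≤ q + A.card := by
  by_contra! hlt
  have hcard : Aᶜ.card = Fintype.card V - A.card := Finset.card_compl A
  obtain ⟨n, hn⟩ := koszul_vanish q _ h Aᶜ 0
    (fun σ => if σ = ∅ then Ideal.Quotient.mk (srIdeal K G Finset.univ) (monomial (indv A) 1) else 0)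
    (by
      intro σ hσ
      by_contra h0
      apply hσ
      rw [if_neg]
      rintro rfl
      exact h0 rfl) (by omega) (by
      intro τ hτ
      unfold kd
      refine Finset.sum_eq_zero fun v hv => ?_
      have hvA : v ∉ A := by simpa using hτ hv
      beta_reduce
      split_ifs with he
      · have e : (X v : MvPolynomial V K) • Ideal.Quotient.mk (srIdeal K G Finset.univ)
            (monomial (indv A) 1) = Ideal.Quotient.mk (srIdeal K G Finset.univ)
            (monomial (indv (insert v A)) 1) := by
          rw [← indv_insert hvA, show monomial (Finsupp.single v 1 + indv A)
            (1 : K) = X v * monomial (indv A) (1 : K) by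
              rw [X, monomial_mul, one_mul]]
          rfl
        rw [e, Ideal.Quotient.eq_zero_iff_mem.2, smul_zero]
        refine monomial_mem_srIdeal ?_ _
        rw [indv_support]
        intro hF
        obtain ⟨u, hu, huv⟩ := hmax v hvA
        exact hF.2 u (Finset.mem_insert_of_mem hu) v (Finset.mem_insert_self _ _) huv
      · simp)
  have h1 := hn ∅ (Finset.empty_subset _)
  simp only [if_true, kd, Finset.sum_empty] at h1
  rw [Ideal.Quotient.eq_zero_iff_mem] at h1
  have h2 := coeff_eq_zero_of_mem h1 (s := indv A) (by rwa [indv_support])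
  simp at h2

/-- Contraction against a vertex. -/
def kcon (v : V) (c : Finset V → K) (σ : Finset V) : K :=
  ksgn v (insert v σ) • c (insert v σ)

theorem kcon_kd (v : V) (a : Finset V → K) {σ : Finset V} (hv : v ∉ σ) :
    kcon v (kd (fun _ => (1 : K)) a) σ = a σ - kd (fun _ => (1 : K)) (kcon v a) σ := by
  unfold kcon kd
  rw [Finset.sum_insert hv, Finset.erase_insert hv, smul_add, smul_smul, ksgn_mul_self, one_smul,
    one_smul, sub_eq_add_neg, ← Finset.sum_neg_distrib, Finset.smul_sum]
  congr 1
  refine Finset.sum_congr rfl fun u hu => ?_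
  have hne : v ≠ u := by rintro rfl; exact hv hu
  have e : insert v (σ.erase u) = (insert v σ).erase u := (Finset.erase_insert_of_ne hne).symm
  rw [one_smul, one_smul]
  beta_reduce
  rw [e, smul_smul, smul_smul, ← neg_smul]
  congr 1
  have h1 := ksgn_anti hne (Finset.mem_insert_self v σ) (Finset.mem_insert_of_mem hu)
  rw [Finset.erase_insert hv] at h1
  have h2 := ksgn_mul_self u σ
  have h3 := ksgn_mul_self u (insert v σ)
  linear_combination (ksgn u σ * ksgn u (insert v σ)) * h1
    - (ksgn v (insert v σ) * ksgn u (insert v σ)) * h2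
    - (ksgn u σ * ksgn v ((insert v σ).erase u)) * h3

/-- Transversals of a family of pairs. -/
def transv (p : ℕ → Bool → V) (s : ℕ → Bool) (L : ℕ) : Finset V :=
  (Finset.range L).image (fun t => p t (s t))

theorem transv_succ (p : ℕ → Bool → V) (s : ℕ → Bool) (L : ℕ) :
    transv p s (L + 1) = insert (p L (s L)) (transv p s L) := by
  unfold transv
  rw [Finset.range_add_one, Finset.image_insert]

theorem transv_congr (p : ℕ → Bool → V) {s s' : ℕ → Bool} {L : ℕ} (h : ∀ t < L, s t = s' t) :
    transv p s L = transv p s' L := by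
  unfold transv
  refine Finset.image_congr fun t ht => ?_
  have := h t (by simpa using ht)
  simp only [this]

theorem cross_detect (p : ℕ → Bool → V) (L : ℕ)
    (hp : ∀ t t' r r', t < t' → t' < L → p t r ≠ p t' r') :
    ∀ c a : Finset V → K, (∀ s, c (transv p s L) = kd (fun _ => (1 : K)) a (transv p s L)) →
      (∀ s, (∃ t < L, s t = false) → c (transv p s L) = 0) →
      c (transv p (fun _ => true) L) = 0 := by
  induction L with
  | zero =>
    intro c a h _
    rw [h]
    simp [transv, kd]
  | succ L ih =>
    intro c a h1 h2
    have hup : ∀ s r, transv p (Function.update s L r) (L + 1) = insert (p L r) (transv p s L) := by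
      intro s r
      rw [transv_succ, Function.update_self]
      congr 1
      refine transv_congr p fun t ht => ?_
      rw [Function.update_of_ne ht.ne]
    have hn : ∀ s r, p L r ∉ transv p s L := by
      intro s r hm
      unfold transv at hm
      obtain ⟨t, ht, h⟩ := Finset.mem_image.1 hm
      exact hp t L _ _ (Finset.mem_range.1 ht) (Nat.lt_succ_self L) h
    have key := ih (fun t t' r r' h h' => hp t t' r r' h (by omega))
      (fun σ => kcon (p L true) c σ - kcon (p L false) c σ)
      (fun σ => kcon (p L false) a σ - kcon (p L true) a σ) (by
        intro s
        have e : ∀ r, kcon (p L r) c (transv p s L) =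
            kcon (p L r) (kd (fun _ => (1 : K)) a) (transv p s L) := by
          intro r
          unfold kcon
          rw [← hup, h1]
        rw [e, e, kcon_kd _ _ (hn s _), kcon_kd _ _ (hn s _), kd_sub]
        ring) (by
        intro s ⟨t, ht, hs⟩
        have e : ∀ r, kcon (p L r) c (transv p s L) = 0 := by
          intro r
          unfold kcon
          rw [← hup, h2, smul_zero]
          exact ⟨t, by omega, by rw [Function.update_of_ne ht.ne, hs]⟩
        rw [e, e, sub_zero])
    have e2 : kcon (p L false) c (transv p (fun _ => true) L) = 0 := by
      unfold kcon
      rw [← hup, h2, smul_zero]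
      exact ⟨L, by omega, by rw [Function.update_self]⟩
    rw [e2, sub_zero] at key
    unfold kcon at key
    rw [transv_succ]
    have h3 := congrArg (fun z => ksgn (p L true) (insert (p L true)
      (transv p (fun _ => true) L)) • z) key
    simpa only [smul_smul, ksgn_mul_self, one_smul, smul_zero] using h3

/-- The facets of the path. -/
def pathF (a b : ℕ → V) (L j : ℕ) : Finset V :=
  (Finset.range j).image a ∪ (Finset.Ico j L).image b

/-- The path coefficients. -/
def pathC (K : Type u) [Field K] (a b : ℕ → V) (L : ℕ) : ℕ → K
  | 0 => 1
  | j + 1 => - ((ksgn (a j) (insert (a j) (pathF a b L j)) *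
      ksgn (b j) (insert (a j) (pathF a b L j)) : ℤ) • pathC K a b L j)

theorem path_bound [Fintype V] {q : ℕ}
    (h : pdimLE (MvPolynomial V K) q (MvPolynomial V K ⧸ srIdeal K G R))
    (L : ℕ) (hL : 0 < L) (a b : ℕ → V) (p : ℕ → Bool → V)
    (haa : ∀ t < L, ∀ t' < L, a t = a t' → t = t')
    (hbb : ∀ t < L, ∀ t' < L, b t = b t' → t = t')
    (hab : ∀ t < L, ∀ t' < L, a t ≠ b t')
    (hap : ∀ t < L, ∀ r, a 0 ≠ p t r)
    (hpb : ∀ t, p t true = b t)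
    (hpf : ∀ t < L, ∀ t' < L, p t false ≠ b t')
    (hp : ∀ t t' r r', t < t' → t' < L → p t r ≠ p t' r')
    (hF : ∀ s, IsFace G R (transv p s L))
    (hlink : ∀ j ≤ L, ∀ v, v ∉ pathF a b L j → IsFace G R (insert v (pathF a b L j)) →
      (j < L ∧ v = a j) ∨ ∃ i < L, j = i + 1 ∧ v = b i) :
    Fintype.card V ≤ q + L := by
  by_contra! hlt
  have hmem : ∀ j ≤ L, ∀ v, v ∈ pathF a b L j ↔ (∃ t < j, a t = v) ∨ (∃ t, j ≤ t ∧ t < L ∧ b t = v) := by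
    intro j _ v
    simp [pathF, and_assoc]
  have hma : ∀ j ≤ L, ∀ t < L, a t ∈ pathF a b L j ↔ t < j := by
    intro j hj t ht
    rw [hmem j hj]
    constructor
    · rintro (⟨t', h1, h2⟩ | ⟨t', h1, h2, h3⟩)
      · rw [← haa t' (by omega) t ht h2]; exact h1
      · exact absurd h3.symm (hab t ht t' h2)
    · intro h1; exact Or.inl ⟨t, h1, rfl⟩
  have hmb : ∀ j ≤ L, ∀ t < L, b t ∈ pathF a b L j ↔ j ≤ t := by
    intro j hj t ht
    rw [hmem j hj]
    constructor
    · rintro (⟨t', h1, h2⟩ | ⟨t', h1, h2, h3⟩)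
      · exact absurd h2 (hab t' (by omega) t ht)
      · rw [← hbb t' (by omega) t ht h3]; exact h1
    · intro h1; exact Or.inr ⟨t, h1, ht, rfl⟩
  have hinj : ∀ i ≤ L, ∀ j ≤ L, pathF a b L i = pathF a b L j → i = j := by
    intro i hi j hj hij
    by_contra hne
    rcases lt_or_gt_of_ne hne with h1 | h1
    · have h2 := (hma j hj i (by omega)).2 h1
      rw [← hij, hma i hi i (by omega)] at h2
      omega
    · have h2 := (hma i hi j (by omega)).2 h1
      rw [hij, hma j hj j (by omega)] at h2
      omega
  have hcard : ∀ j ≤ L, (pathF a b L j).card = L := by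
    intro j hj
    unfold pathF
    rw [Finset.card_union_of_disjoint, Finset.card_image_of_injOn, Finset.card_image_of_injOn]
    · simp; omega
    · intro x hx y hy hxy
      simp at hx hy
      exact hbb x (by omega) y (by omega) hxy
    · intro x hx y hy hxy
      simp at hx hy
      exact haa x (by omega) y (by omega) hxy
    · rw [Finset.disjoint_left]
      intro v hv hv'
      simp at hv hv'
      obtain ⟨t, ht, rfl⟩ := hv
      obtain ⟨t', ht', h2⟩ := hv'
      exact hab t (by omega) t' (by omega) h2.symm
  have hstep : ∀ j < L, (insert (a j) (pathF a b L j)).erase (b j) = pathF a b L (j + 1) := by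
    intro j hj
    ext v
    rw [Finset.mem_erase, Finset.mem_insert, hmem j hj.le, hmem (j + 1) hj]
    constructor
    · rintro ⟨h1, rfl | ⟨t, h2, rfl⟩ | ⟨t, h2, h3, rfl⟩⟩
      · exact Or.inl ⟨j, by omega, rfl⟩
      · exact Or.inl ⟨t, by omega, rfl⟩
      · refine Or.inr ⟨t, ?_, h3, rfl⟩
        have : t ≠ j := by rintro rfl; exact h1 rfl
        omega
    · rintro (⟨t, h2, rfl⟩ | ⟨t, h2, h3, rfl⟩)
      · refine ⟨hab t (by omega) j hj, ?_⟩
        rcases Nat.lt_succ_iff_lt_or_eq.1 h2 with h4 | rfl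
        · exact Or.inr (Or.inl ⟨t, h4, rfl⟩)
        · exact Or.inl rfl
      · refine ⟨fun h4 => ?_, Or.inr (Or.inr ⟨t, by omega, h3, rfl⟩)⟩
        have := hbb t h3 j hj h4
        omega
  have hbj : ∀ j < L, b j ∈ insert (a j) (pathF a b L j) := fun j hj =>
    Finset.mem_insert_of_mem ((hmb j hj.le j hj).2 le_rfl)
  have hτinj : ∀ i < L, ∀ j < L, insert (a i) (pathF a b L i) = insert (a j) (pathF a b L j) → i = j := by
    intro i hi j hj hij
    have h1 := hbj i hi
    have h2 := Finset.mem_insert_self (a i) (pathF a b L i)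
    rw [hij, Finset.mem_insert] at h1 h2
    have h3 : j ≤ i := by
      rcases h1 with h1 | h1
      · exact absurd h1.symm (hab j hj i hi)
      · exact (hmb j hj.le i hi).1 h1
    have h4 : i ≤ j := by
      rcases h2 with h2 | h2
      · exact (haa i hi j hj h2).le
      · exact ((hma j hj.le i hi).1 h2).le
    omega
  let c : Finset V → K := fun σ => ∑ j ∈ Finset.range (L + 1),
    if σ = pathF a b L j then pathC K a b L j else 0
  have hc : ∀ j ≤ L, c (pathF a b L j) = pathC K a b L j := by
    intro j hj
    simp only [c]
    rw [Finset.sum_eq_single j]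
    · simp
    · intro i hi hne
      rw [if_neg]
      intro h1
      exact hne (hinj i (by simp at hi; omega) j hj h1.symm)
    · intro h1; simp at h1; omega
  have hc0 : ∀ σ, c σ ≠ 0 → ∃ j ≤ L, σ = pathF a b L j := by
    intro σ hσ
    obtain ⟨j, hj, h1⟩ := Finset.exists_ne_zero_of_sum_ne_zero hσ
    refine ⟨j, by simp at hj; omega, ?_⟩
    by_contra h2
    exact h1 (if_neg h2)
  -- where the terms of the differential can be nonzero
  have hterm : ∀ τ, IsFace G R τ → ∀ v ∈ τ, c (τ.erase v) ≠ 0 →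
      ∃ j < L, τ = insert (a j) (pathF a b L j) ∧ (v = a j ∨ v = b j) := by
    intro τ hτ v hv hne
    obtain ⟨j, hj, h1⟩ := hc0 _ hne
    have h2 : v ∉ pathF a b L j := by rw [← h1]; exact Finset.notMem_erase _ _
    have h3 : τ = insert v (pathF a b L j) := by rw [← h1, Finset.insert_erase hv]
    rcases hlink j hj v h2 (h3 ▸ hτ) with ⟨h4, h5⟩ | ⟨i, hi, h4, h5⟩
    · exact ⟨j, h4, by rw [h3, h5], Or.inl h5⟩
    · refine ⟨i, hi, ?_, Or.inr h5⟩
      rw [h3, h5, h4, ← hstep i hi, Finset.insert_erase (hbj i hi)]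
  obtain ⟨α, hα⟩ := hochster h (i := L) (by omega) c (by
    intro σ hσ
    obtain ⟨j, hj, rfl⟩ := hc0 σ hσ
    exact hcard j hj) (by
    intro τ hτ
    by_contra hne
    obtain ⟨v, hv, h1⟩ := Finset.exists_ne_zero_of_sum_ne_zero hne
    obtain ⟨j, hj, rfl, _⟩ := hterm τ hτ v hv (fun h0 => h1 (by simp [h0]))
    apply hne
    have hajn : a j ∉ pathF a b L j := by rw [hma j hj.le j hj]; omega
    unfold kd
    rw [← Finset.sum_subset (s₁ := {a j, b j})]
    · rw [Finset.sum_pair (hab j hj j hj), Finset.erase_insert hajn, hstep j hj, hc j hj.le,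
        hc (j + 1) hj]
      simp only [pathC, one_smul]
      rw [smul_neg, smul_smul, mul_comm (ksgn (a j) _) (ksgn (b j) _), ← mul_assoc,
        ksgn_mul_self, one_mul, add_neg_cancel]
    · intro u hu
      simp only [Finset.mem_insert, Finset.mem_singleton] at hu
      rcases hu with rfl | rfl
      · exact Finset.mem_insert_self _ _
      · exact hbj j hj
    · intro u hu hu'
      by_contra h2
      obtain ⟨i, hi, h3, h4⟩ := hterm _ hτ u hu (fun h0 => h2 (by simp [h0]))
      have := hτinj j hj i hi h3
      subst this
      apply hu'
      simpa using h4)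
  have h0 := cross_detect p L hp c α (fun s => hα _ (hF s)) (by
    rintro s ⟨t, ht, hs⟩
    by_contra hne
    obtain ⟨j, hj, h1⟩ := hc0 _ hne
    rcases Nat.eq_zero_or_pos j with rfl | hj0
    · have h2 : p t (s t) ∈ transv p s L := Finset.mem_image.2 ⟨t, by simpa using ht, rfl⟩
      rw [h1, hmem 0 hj] at h2
      rcases h2 with ⟨t', h3, _⟩ | ⟨t', _, h3, h4⟩
      · omega
      · rw [hs] at h4
        exact hpf t ht t' h3 h4.symm
    · have h2 : a 0 ∈ pathF a b L j := (hma j hj 0 hL).2 hj0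
      rw [← h1] at h2
      obtain ⟨t', h3, h4⟩ := Finset.mem_image.1 h2
      exact hap t' (by simpa using h3) _ h4.symm)
  have h5 : transv p (fun _ => true) L = pathF a b L 0 := by
    unfold transv pathF
    simp [hpb]
  rw [h5, hc 0 (Nat.zero_le _)] at h0
  simp [pathC] at h0
end Hochster

section Circ

theorem circ_adj {n : ℕ} (hn : 2 ≤ n) (i j : Fin (2 * n)) :
    (circulantGraph (2 * n) ({1, n} : Set ℕ)).Adj i j ↔
      ((i : ℕ) + 1 = j ∨ (j : ℕ) + 1 = i ∨ (i : ℕ) + n = j ∨ (j : ℕ) + n = i ∨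
        ((i : ℕ) = 0 ∧ (j : ℕ) + 1 = 2 * n) ∨ ((j : ℕ) = 0 ∧ (i : ℕ) + 1 = 2 * n)) := by
  have hi := i.2
  have hj := j.2
  unfold circulantGraph
  simp only [SimpleGraph.fromRel_adj, ne_eq, Fin.ext_iff, Set.mem_insert_iff, Set.mem_singleton_iff]
  omega

/-- Vertex of the circulant graph with given index. -/
def vx (n : ℕ) (hn : 2 ≤ n) (x : ℕ) : Fin (2 * n) := ⟨x % (2 * n), Nat.mod_lt _ (by omega)⟩

theorem vx_val {n : ℕ} (hn : 2 ≤ n) {x : ℕ} (hx : x < 2 * n) : (vx n hn x : ℕ) = x :=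
  Nat.mod_eq_of_lt hx

theorem vx_inj {n : ℕ} (hn : 2 ≤ n) {x y : ℕ} (hx : x < 2 * n) (hy : y < 2 * n) :
    vx n hn x = vx n hn y ↔ x = y := by
  rw [Fin.ext_iff, vx_val hn hx, vx_val hn hy]

theorem path_lower {K : Type u} [Field K] {n L o q : ℕ} (hn : 2 ≤ n) (ho : o ≤ 1)
    (hL : n = 2 * L + o) (R : Finset (Fin (2 * n)))
    (hR : ∀ v : Fin (2 * n), v ∈ R ↔ (o = 1 → (v : ℕ) ≠ 0 ∧ (v : ℕ) ≠ n))
    (h : pdimLE (MvPolynomial (Fin (2 * n)) K) q (MvPolynomial (Fin (2 * n)) K ⧸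
      srIdeal K (circulantGraph (2 * n) ({1, n} : Set ℕ)) R)) : 2 * n ≤ q + L := by
  have hp1 : ∀ (t : ℕ) (r : Bool), 2 * t + 1 + o + (if (t % 2 = 0 ↔ r = true) then n else 0) =
      2 * t + 1 + o ∨ 2 * t + 1 + o + (if (t % 2 = 0 ↔ r = true) then n else 0) =
      2 * t + 1 + o + n := by
    intro t r
    split_ifs
    · right; rfl
    · left; rfl
  have key := path_bound h L (by omega)
    (fun t => vx n hn (2 * t + o + (if t % 2 = 0 then 0 else n)))
    (fun t => vx n hn (2 * t + 1 + o + (if t % 2 = 0 then n else 0)))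
    (fun t r => vx n hn (2 * t + 1 + o + (if (t % 2 = 0 ↔ r = true) then n else 0)))
    (by
      intro t ht t' ht' h1
      rw [vx_inj hn (by split_ifs <;> omega) (by split_ifs <;> omega)] at h1
      split_ifs at h1 <;> omega)
    (by
      intro t ht t' ht' h1
      rw [vx_inj hn (by split_ifs <;> omega) (by split_ifs <;> omega)] at h1
      split_ifs at h1 <;> omega)
    (by
      intro t ht t' ht' h1
      rw [vx_inj hn (by split_ifs <;> omega) (by split_ifs <;> omega)] at h1
      split_ifs at h1 <;> omega)
    (by
      intro t ht r h1
      have := hp1 t r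
      rw [vx_inj hn (by split_ifs <;> omega) (by omega)] at h1
      simp only [Nat.zero_mod, if_true] at h1
      omega)
    (by
      intro t
      simp)
    (by
      intro t ht t' ht' h1
      rw [vx_inj hn (by split_ifs <;> omega) (by split_ifs <;> omega)] at h1
      simp only [Bool.false_eq_true, iff_false] at h1
      split_ifs at h1 <;> omega)
    (by
      intro t t' r r' ht ht' h1
      have := hp1 t r
      have := hp1 t' r'
      rw [vx_inj hn (by omega) (by omega)] at h1
      omega)
    (by
      intro s
      constructor
      · intro v hv
        obtain ⟨t, ht, rfl⟩ := Finset.mem_image.1 hv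
        have ht := Finset.mem_range.1 ht
        have := hp1 t (s t)
        rw [hR, vx_val hn (by omega)]
        omega
      · intro u hu v hv hadj
        obtain ⟨t, ht, rfl⟩ := Finset.mem_image.1 hu
        obtain ⟨t', ht', rfl⟩ := Finset.mem_image.1 hv
        have ht := Finset.mem_range.1 ht
        have ht' := Finset.mem_range.1 ht'
        by_cases he : t = t'
        · subst he; exact hadj.ne rfl
        have := hp1 t (s t)
        have := hp1 t' (s t')
        rw [circ_adj hn, vx_val hn (by omega), vx_val hn (by omega)] at hadj
        omega)
    (by
      intro j hj v hv hF
      have hvR := (hR v).1 (hF.1 (Finset.mem_insert_self _ _))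
      have hvlt := v.2
      set a : ℕ → Fin (2 * n) := fun t => vx n hn (2 * t + o + (if t % 2 = 0 then 0 else n)) with ha
      set b : ℕ → Fin (2 * n) := fun t => vx n hn (2 * t + 1 + o + (if t % 2 = 0 then n else 0))
        with hb
      have hav : ∀ t < L, (a t : ℕ) = 2 * t + o + (if t % 2 = 0 then 0 else n) := fun t ht =>
        vx_val hn (by split_ifs <;> omega)
      have hbv : ∀ t < L, (b t : ℕ) = 2 * t + 1 + o + (if t % 2 = 0 then n else 0) := fun t ht =>
        vx_val hn (by split_ifs <;> omega)
      have hA : ∀ t < j, v ≠ a t ∧ ¬ (circulantGraph (2 * n) ({1, n} : Set ℕ)).Adj v (a t) := by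
        intro t ht
        have hm : a t ∈ pathF a b L j := by
          unfold pathF
          exact Finset.mem_union_left _ (Finset.mem_image_of_mem _ (Finset.mem_range.2 ht))
        exact ⟨fun e => hv (e ▸ hm), hF.2 v (Finset.mem_insert_self _ _) _
          (Finset.mem_insert_of_mem hm)⟩
      have hB : ∀ t, j ≤ t → t < L →
          v ≠ b t ∧ ¬ (circulantGraph (2 * n) ({1, n} : Set ℕ)).Adj v (b t) := by
        intro t ht ht'
        have hm : b t ∈ pathF a b L j := by
          unfold pathF
          exact Finset.mem_union_right _ (Finset.mem_image_of_mem _ (Finset.mem_Ico.2 ⟨ht, ht'⟩))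
        exact ⟨fun e => hv (e ▸ hm), hF.2 v (Finset.mem_insert_self _ _) _
          (Finset.mem_insert_of_mem hm)⟩
      simp only [circ_adj hn, ne_eq, Fin.ext_iff] at hA hB ⊢
      obtain ⟨x, hx⟩ : ∃ x : ℕ, (v : ℕ) = x := ⟨_, rfl⟩
      rw [hx] at hA hB hvR hvlt ⊢
      have hA' : ∀ t < j, ∀ y, y = 2 * t + o + (if t % 2 = 0 then 0 else n) →
          ¬ x = y ∧ ¬ (x + 1 = y ∨ y + 1 = x ∨ x + n = y ∨ y + n = x) := by
        intro t ht y hy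
        have := hA t ht
        rw [hav t (by omega), ← hy] at this
        tauto
      have hB' : ∀ t, j ≤ t → t < L → ∀ y, y = 2 * t + 1 + o + (if t % 2 = 0 then n else 0) →
          ¬ x = y ∧ ¬ (x + 1 = y ∨ y + 1 = x ∨ x + n = y ∨ y + n = x) := by
        intro t ht ht' y hy
        have := hB t ht ht'
        rw [hbv t (by omega), ← hy] at this
        tauto
      clear hA hB
      obtain ⟨t, ht, hc⟩ : ∃ t < L, (x = 2 * t + o ∨ x = 2 * t + o + n) ∨
          (x = 2 * t + 1 + o ∨ x = 2 * t + 1 + o + n) := by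
        by_cases hxn : x < n
        · exact ⟨(x - o) / 2, by omega, by omega⟩
        · exact ⟨(x - n - o) / 2, by omega, by omega⟩
      have hq1 := Nat.mod_two_eq_zero_or_one t
      rcases hc with hc | hc
      · by_cases hrow : x = 2 * t + o + (if t % 2 = 0 then 0 else n)
        · rcases lt_trichotomy t j with h1 | h1 | h1
          · exact absurd hrow (hA' t h1 _ rfl).1
          · subst h1
            left
            exact ⟨ht, by rw [hav t ht]; exact hrow⟩
          · exfalso
            have h2 := (hB' (t - 1) (by omega) (by omega) _ rfl).2
            split_ifs at h2 hrow <;> omega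
        · exfalso
          by_cases h1 : t < j
          · have h2 := (hA' t h1 _ rfl).2
            split_ifs at h2 hrow <;> omega
          · have h2 := (hB' t (by omega) (by omega) _ rfl).2
            split_ifs at h2 hrow <;> omega
      · by_cases hrow : x = 2 * t + 1 + o + (if t % 2 = 0 then n else 0)
        · by_cases h1 : j ≤ t
          · exact absurd hrow (hB' t h1 ht _ rfl).1
          by_cases h1' : j = t + 1
          · right
            exact ⟨t, ht, h1', by rw [hbv t ht]; exact hrow⟩
          · exfalso
            have h2 := (hA' (t + 1) (by omega) _ rfl).2
            split_ifs at h2 hrow <;> omega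
        · exfalso
          by_cases h1 : t < j
          · have h2 := (hA' t h1 _ rfl).2
            split_ifs at h2 hrow <;> omega
          · have h2 := (hB' t (by omega) (by omega) _ rfl).2
            split_ifs at h2 hrow <;> omega)
  rw [Fintype.card_fin] at key
  exact key

theorem socle_lower {K : Type u} [Field K] {n k q : ℕ} (hn : 2 ≤ n) (hk : n = 4 * k + 1)
    (h : pdimLE (MvPolynomial (Fin (2 * n)) K) q (MvPolynomial (Fin (2 * n)) K ⧸
      srIdeal K (circulantGraph (2 * n) ({1, n} : Set ℕ)) Finset.univ)) :
    2 * n ≤ q + (2 * k + 1) := by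
  have hval : ∀ t < 2 * k + 1, (vx n hn (2 * t + (if t % 2 = 0 then 0 else n)) : ℕ) =
    2 * t + (if t % 2 = 0 then 0 else n) := fun t ht => vx_val hn (by split_ifs <;> omega)
  have key := socle_bound h ((Finset.range (2 * k + 1)).image
    (fun t => vx n hn (2 * t + (if t % 2 = 0 then 0 else n)))) (by
      refine ⟨Finset.subset_univ _, fun u hu v hv hadj => ?_⟩
      obtain ⟨t, ht, rfl⟩ := Finset.mem_image.1 hu
      obtain ⟨t', ht', rfl⟩ := Finset.mem_image.1 hv
      have ht := Finset.mem_range.1 ht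
      have ht' := Finset.mem_range.1 ht'
      rw [circ_adj hn, hval t ht, hval t' ht'] at hadj
      split_ifs at hadj <;> omega) (by
      intro v hv
      have hvlt := v.2
      have hv' : ∀ t < 2 * k + 1, (v : ℕ) ≠ 2 * t + (if t % 2 = 0 then 0 else n) := by
        intro t ht h1
        apply hv
        refine Finset.mem_image.2 ⟨t, by simpa using ht, ?_⟩
        rw [Fin.ext_iff, hval t ht, h1]
      suffices hs : ∃ t < 2 * k + 1, (circulantGraph (2 * n) ({1, n} : Set ℕ)).Adj
          (vx n hn (2 * t + (if t % 2 = 0 then 0 else n))) v by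
        obtain ⟨t, ht, h1⟩ := hs
        exact ⟨_, Finset.mem_image.2 ⟨t, by simpa using ht, rfl⟩, h1⟩
      simp only [circ_adj hn]
      obtain ⟨x, hx⟩ : ∃ x : ℕ, (v : ℕ) = x := ⟨_, rfl⟩
      rw [hx] at hv' hvlt ⊢
      obtain ⟨t, ht, hc⟩ : ∃ t < 2 * k + 1, (x = 2 * t ∨ x = 2 * t + n) ∨
          ((x = 2 * t + 1 ∨ x = 2 * t + 1 + n) ∧ t < 2 * k) := by
        by_cases hxn : x < n
        · exact ⟨x / 2, by omega, by omega⟩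
        · exact ⟨(x - n) / 2, by omega, by omega⟩
      rcases hc with hc | ⟨hc, htk⟩
      · refine ⟨t, ht, ?_⟩
        have h1 := hv' t ht
        rw [hval t ht]
        split_ifs at h1 ⊢ <;> omega
      · by_cases h1 : x = 2 * t + 1 + (if t % 2 = 0 then 0 else n)
        · refine ⟨t, ht, ?_⟩
          rw [hval t ht]
          split_ifs at h1 ⊢ <;> omega
        · refine ⟨t + 1, by omega, ?_⟩
          rw [hval (t + 1) (by omega)]
          split_ifs at h1 ⊢ <;> omega)
  rw [Fintype.card_fin] at key
  have := Finset.card_image_le (s := Finset.range (2 * k + 1))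
    (f := fun t => vx n hn (2 * t + (if t % 2 = 0 then 0 else n)))
  rw [Finset.card_range] at this
  omega
end Circ

section GameLemmas
variable {V : Type} [DecidableEq V] {G : SimpleGraph V} [DecidableRel G.Adj]

theorem Game.mono {R : Finset V} {d d' : ℕ} (h : Game G R d) (hd : d' ≤ d) : Game G R d' := by
  induction h with
  | done R d h1 h2 => exact Game.done R d' h1 (hd.trans h2)
  | step R d v hv _ _ ih1 ih2 => exact Game.step R d' v hv (ih1 hd) (ih2 hd)

theorem Game.insert_isolated {R : Finset V} {d : ℕ} (h : Game G R d) {t : V} (ht : t ∉ R)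
    (hadj : ∀ u ∈ R, ¬ G.Adj t u) : Game G (insert t R) (d + 1) := by
  induction h with
  | done R d h1 h2 =>
    refine Game.done _ _ ?_ (by rw [Finset.card_insert_of_notMem ht]; omega)
    intro u hu v hv
    rcases Finset.mem_insert.1 hu with h4 | h4 <;> rcases Finset.mem_insert.1 hv with h5 | h5
    · subst h4; subst h5; exact G.irrefl
    · subst h4; exact hadj v h5
    · subst h5; exact fun h => hadj u h4 h.symm
    · exact h1 u h4 v h5
  | step R d v hv _ _ ih1 ih2 =>
    have hne : t ≠ v := by rintro rfl; exact ht hv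
    refine Game.step _ _ v (Finset.mem_insert_of_mem hv) ?_ ?_
    · rw [Finset.erase_insert_of_ne hne]
      exact ih1 (fun h => ht (Finset.mem_of_mem_erase h))
        (fun u hu => hadj u (Finset.mem_of_mem_erase hu))
    · rw [Finset.filter_insert, if_pos (fun h => hadj v hv h.symm)]
      exact ih2 (fun h => ht (Finset.mem_filter.1 h).1)
        (fun u hu => hadj u (Finset.mem_filter.1 hu).1)

theorem Game.of_nonempty {R : Finset V} (hR : R.Nonempty) : Game G R 1 := by
  induction R using Finset.strongInduction with
  | H R ih =>
    by_cases h : ∀ u ∈ R, ∀ v ∈ R, ¬ G.Adj u v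
    · exact Game.done R 1 h hR.card_pos
    · push Not at h
      obtain ⟨u, hu, v, hv, huv⟩ := h
      refine Game.step R 1 u hu (ih _ (Finset.erase_ssubset hu)
        ⟨v, Finset.mem_erase.2 ⟨huv.ne', hv⟩⟩) (ih _ ?_ ⟨u, Finset.mem_filter.2 ⟨hu, G.irrefl⟩⟩)
      refine (Finset.filter_ssubset).2 ⟨v, hv, by simpa using huv⟩

theorem Game.map {W : Type} [DecidableEq W] {H : SimpleGraph W} [DecidableRel H.Adj]
    {R : Finset V} {d : ℕ} (h : Game G R d) (f : V → W)
    (hinj : ∀ u ∈ R, ∀ v ∈ R, f u = f v → u = v)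
    (hadj : ∀ u ∈ R, ∀ v ∈ R, H.Adj (f u) (f v) ↔ G.Adj u v) : Game H (R.image f) d := by
  induction h with
  | done R d h1 h2 =>
    refine Game.done _ _ ?_ ?_
    · intro u hu v hv
      obtain ⟨u', hu', rfl⟩ := Finset.mem_image.1 hu
      obtain ⟨v', hv', rfl⟩ := Finset.mem_image.1 hv
      rw [hadj u' hu' v' hv']
      exact h1 u' hu' v' hv'
    · rw [Finset.card_image_of_injOn (fun u hu v hv => hinj u hu v hv)]
      exact h2
  | step R d v hv _ _ ih1 ih2 =>
    refine Game.step _ _ (f v) (Finset.mem_image_of_mem f hv) ?_ ?_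
    · have e : (R.image f).erase (f v) = (R.erase v).image f := by
        ext w
        simp only [Finset.mem_erase, Finset.mem_image]
        constructor
        · rintro ⟨h1, u, hu, rfl⟩
          exact ⟨u, ⟨fun h => h1 (by rw [h]), hu⟩, rfl⟩
        · rintro ⟨u, ⟨h1, hu⟩, rfl⟩
          exact ⟨fun h => h1 (hinj u hu v hv h), u, hu, rfl⟩
      rw [e]
      exact ih1 (fun u hu w hw => hinj u (Finset.mem_of_mem_erase hu) w (Finset.mem_of_mem_erase hw))
        (fun u hu w hw => hadj u (Finset.mem_of_mem_erase hu) w (Finset.mem_of_mem_erase hw))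
    · have e : (R.image f).filter (fun u => ¬ H.Adj (f v) u) =
          (R.filter (fun u => ¬ G.Adj v u)).image f := by
        ext w
        simp only [Finset.mem_filter, Finset.mem_image]
        constructor
        · rintro ⟨⟨u, hu, rfl⟩, h1⟩
          exact ⟨u, ⟨hu, by rwa [← hadj v hv u hu]⟩, rfl⟩
        · rintro ⟨u, ⟨hu, h1⟩, rfl⟩
          exact ⟨⟨u, hu, rfl⟩, by rwa [hadj v hv u hu]⟩
      rw [e]
      exact ih2 (fun u hu w hw => hinj u (Finset.mem_filter.1 hu).1 w (Finset.mem_filter.1 hw).1)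
        (fun u hu w hw => hadj u (Finset.mem_filter.1 hu).1 w (Finset.mem_filter.1 hw).1)
end GameLemmas

section Ladder

/-- The infinite ladder. -/
def ladder : SimpleGraph (ℕ × Bool) where
  Adj p q := (p.1 = q.1 ∧ p.2 ≠ q.2) ∨ (p.2 = q.2 ∧ (p.1 + 1 = q.1 ∨ q.1 + 1 = p.1))
  symm := ⟨by
    rintro p q (⟨h1, h2⟩ | ⟨h1, h2⟩)
    · exact Or.inl ⟨h1.symm, h2.symm⟩
    · exact Or.inr ⟨h1.symm, h2.symm⟩⟩
  loopless := ⟨by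
    rintro p (⟨_, h⟩ | ⟨_, h⟩)
    · exact h rfl
    · omega⟩

theorem ladder_adj (p q : ℕ × Bool) : ladder.Adj p q ↔
    (p.1 = q.1 ∧ p.2 ≠ q.2) ∨ (p.2 = q.2 ∧ (p.1 + 1 = q.1 ∨ q.1 + 1 = p.1)) := Iff.rfl

instance : DecidableRel ladder.Adj := fun p q =>
  decidable_of_iff _ (ladder_adj p q).symm

/-- Pieces of the ladder: one vertex in column `a`, full columns strictly between, and
the rows `E` in column `b`. -/
def lq (a : ℕ) (ε : Bool) (b : ℕ) (E : Bool → Bool) : Finset (ℕ × Bool) :=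
  (Finset.range (a + b + 1) ×ˢ Finset.univ).filter
    (fun p => (p.1 = a ∧ p.2 = ε) ∨ (a < p.1 ∧ p.1 < b) ∨ (a < p.1 ∧ p.1 = b ∧ E p.2 = true))

theorem mem_lq {a : ℕ} {ε : Bool} {b : ℕ} {E : Bool → Bool} {p : ℕ × Bool} :
    p ∈ lq a ε b E ↔ (p.1 = a ∧ p.2 = ε) ∨ (a < p.1 ∧ p.1 < b) ∨
      (a < p.1 ∧ p.1 = b ∧ E p.2 = true) := by
  unfold lq
  simp only [Finset.mem_filter, Finset.mem_product, Finset.mem_range, Finset.mem_univ, and_true]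
  constructor
  · exact fun h => h.2
  · intro h
    exact ⟨by omega, h⟩

theorem lq_move {a : ℕ} {ε : Bool} {b : ℕ} {E : Bool → Bool} {d : ℕ} (hab : a + 1 < b)
    (hE : a + 2 < b ∨ E (!ε) = true) (h1 : Game ladder (lq (a + 1) (!ε) b E) d)
    (h2 : Game ladder (lq (a + 2) (!ε) b E) d) : Game ladder (lq a ε b E) (d + 1) := by
  refine Game.step _ _ (a + 1, ε) (mem_lq.2 (Or.inr (Or.inl ⟨by simp, by simpa using hab⟩))) ?_ ?_
  · have e : (lq a ε b E).erase (a + 1, ε) = insert (a, ε) (lq (a + 1) (!ε) b E) := by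
      ext ⟨i, δ⟩
      simp only [Finset.mem_erase, Finset.mem_insert, mem_lq, Prod.mk.injEq, ne_eq]
      by_cases hδ : δ = ε
      · have hne : ¬ δ = !ε := by rw [hδ]; simp
        simp only [hδ, and_true]
        simp only [Bool.eq_not_self, and_false, false_or]
        by_cases hEE : E ε = true
        · simp only [hEE, and_true]; omega
        · simp only [hEE, Bool.false_eq_true, and_false, or_false]; omega
      · have hne : δ = !ε := by revert hδ; cases δ <;> cases ε <;> simp
        simp only [hδ, and_false, false_or, not_false_eq_true, true_and]
        simp only [hne, and_true]
        by_cases hEE : E (!ε) = true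
        · simp only [hEE, and_true]; omega
        · simp only [hEE, Bool.false_eq_true, and_false, or_false]; omega
    rw [e]
    refine h1.insert_isolated ?_ ?_
    · rw [mem_lq]; simp
    · rintro ⟨i, δ⟩ hu hadj
      rw [mem_lq] at hu
      rw [ladder_adj] at hadj
      simp only at hu hadj
      rcases hadj with ⟨h3, h4⟩ | ⟨h3, h4⟩
      · omega
      · subst h3
        simp at hu
        omega
  · have e : (lq a ε b E).filter (fun u => ¬ ladder.Adj (a + 1, ε) u) =
        insert (a + 1, ε) (lq (a + 2) (!ε) b E) := by
      ext ⟨i, δ⟩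
      simp only [Finset.mem_filter, Finset.mem_insert, mem_lq, Prod.mk.injEq, ladder_adj]
      by_cases hδ : δ = ε
      · simp only [hδ, and_true, ne_eq, not_true_eq_false, and_false, false_or, true_and]
        simp only [Bool.eq_not_self, and_false, false_or]
        by_cases hEE : E ε = true
        · simp only [hEE, and_true]; omega
        · simp only [hEE, Bool.false_eq_true, and_false, or_false]; omega
      · have hne : δ = !ε := by revert hδ; cases δ <;> cases ε <;> simp
        have hδ' : ¬ ε = δ := fun h => hδ h.symm
        simp only [hδ, hδ', and_false, false_or, ne_eq, not_false_eq_true, and_true, or_false,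
          false_and]
        simp only [hne, and_true]
        by_cases hEE : E (!ε) = true
        · simp only [hEE, and_true]; omega
        · simp only [hEE, Bool.false_eq_true, or_false] at hE
          simp only [hEE, Bool.false_eq_true, and_false, or_false]; omega
    rw [e]
    refine h2.insert_isolated ?_ ?_
    · rw [mem_lq]; simp
    · rintro ⟨i, δ⟩ hu hadj
      rw [mem_lq] at hu
      rw [ladder_adj] at hadj
      simp only at hu hadj
      rcases hadj with ⟨h3, h4⟩ | ⟨h3, h4⟩
      · omega
      · subst h3
        simp at hu
        omega

theorem lq_nonempty (a : ℕ) (ε : Bool) (b : ℕ) (E : Bool → Bool) : (lq a ε b E).Nonempty :=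
  ⟨(a, ε), mem_lq.2 (Or.inl ⟨rfl, rfl⟩)⟩

theorem lq_full (m : ℕ) : ∀ (a : ℕ) (ε : Bool),
    Game ladder (lq a ε (a + m) (fun _ => true)) (m / 2 + 1) := by
  induction m using Nat.strong_induction_on with
  | _ m ih =>
    intro a ε
    by_cases hm : m < 2
    · have : m / 2 = 0 := by omega
      rw [this]
      exact Game.of_nonempty (lq_nonempty _ _ _ _)
    · have h1 := ih (m - 1) (by omega) (a + 1) (!ε)
      have h2 := ih (m - 2) (by omega) (a + 2) (!ε)
      rw [show a + 1 + (m - 1) = a + m by omega] at h1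
      rw [show a + 2 + (m - 2) = a + m by omega] at h2
      exact lq_move (by omega) (Or.inr rfl) (h1.mono (by omega)) (h2.mono (by omega))

theorem lq_single (m : ℕ) : ∀ (a : ℕ) (ε : Bool),
    Game ladder (lq a ε (a + m + 1) (fun δ => δ == ε)) (2 * ((m + 2) / 4) + 1) ∧
    Game ladder (lq a ε (a + m + 1) (fun δ => δ == !ε)) (2 * (m / 4) + 2) := by
  induction m using Nat.strong_induction_on with
  | _ m ih =>
    intro a ε
    by_cases hm : m < 2
    · have : (m + 2) / 4 = 0 := by omega
      have h4 : m / 4 = 0 := by omega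
      rw [this, h4]
      refine ⟨Game.of_nonempty (lq_nonempty _ _ _ _), ?_⟩
      have : m = 0 ∨ m = 1 := by omega
      rcases this with rfl | rfl
      · have e : lq a ε (a + 0 + 1) (fun δ => δ == !ε) = {(a, ε), (a + 1, !ε)} := by
          ext ⟨i, δ⟩
          simp only [mem_lq, Finset.mem_insert, Finset.mem_singleton, Prod.mk.injEq, beq_iff_eq]
          constructor
          · rintro (h | h | h)
            · exact Or.inl h
            · omega
            · exact Or.inr ⟨by omega, h.2.2⟩
          · rintro (h | h)
            · exact Or.inl h
            · exact Or.inr (Or.inr ⟨by omega, by omega, h.2⟩)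
        rw [e]
        refine Game.done _ _ ?_ ?_
        · intro u hu v hv
          simp only [Finset.mem_insert, Finset.mem_singleton] at hu hv
          rcases hu with rfl | rfl <;> rcases hv with rfl | rfl <;> simp [ladder_adj]
        · rw [Finset.card_pair]
          simp
      · refine lq_move (by omega) (Or.inr (by simp)) (Game.of_nonempty (lq_nonempty _ _ _ _))
          (Game.of_nonempty (lq_nonempty _ _ _ _))
    · obtain ⟨h1, h1'⟩ := ih (m - 1) (by omega) (a + 1) (!ε)
      obtain ⟨h2, h2'⟩ := ih (m - 2) (by omega) (a + 2) (!ε)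
      rw [show a + 1 + (m - 1) + 1 = a + m + 1 by omega] at h1 h1'
      rw [show a + 2 + (m - 2) + 1 = a + m + 1 by omega] at h2 h2'
      rw [Bool.not_not] at h1' h2'
      constructor
      · exact (lq_move (d := 2 * ((m - 2) / 4) + 2) (by omega) (Or.inl (by omega))
          (h1'.mono (by omega)) (h2'.mono (by omega))).mono (by omega)
      · exact (lq_move (d := 2 * (m / 4) + 1) (by omega) (Or.inl (by omega))
          (h1.mono (by omega)) (h2.mono (by omega))).mono (by omega)
end Ladder

section CircGame
variable {n : ℕ} [DecidableRel (circulantGraph (2 * n) ({1, n} : Set ℕ)).Adj]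

theorem circ_tr (hn : 2 ≤ n) {a : ℕ} {ε : Bool} {b : ℕ} {E : Bool → Bool} {d : ℕ}
    (h : Game ladder (lq a ε b E) d) (ha : 1 ≤ a) (hab : a ≤ b) (hb : b + 1 ≤ n)
    {R : Finset (Fin (2 * n))}
    (hR : ∀ v : Fin (2 * n), v ∈ R ↔ ((v : ℕ) < n ∧ ((v : ℕ), false) ∈ lq a ε b E) ∨
      (n ≤ (v : ℕ) ∧ ((v : ℕ) - n, true) ∈ lq a ε b E)) :
    Game (circulantGraph (2 * n) ({1, n} : Set ℕ)) R d := by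
  have hr : ∀ p ∈ lq a ε b E, 1 ≤ p.1 ∧ p.1 < n := by
    intro p hp
    rw [mem_lq] at hp
    omega
  have e : R = (lq a ε b E).image (fun p => vx n hn (p.1 + if p.2 = true then n else 0)) := by
    ext v
    rw [hR, Finset.mem_image]
    constructor
    · rintro (⟨h1, h2⟩ | ⟨h1, h2⟩)
      · exact ⟨_, h2, by rw [Fin.ext_iff, vx_val hn (by simp)]; simp⟩
      · have := v.2
        exact ⟨_, h2, by rw [Fin.ext_iff, vx_val hn (by simp; omega)]; simp; omega⟩
    · rintro ⟨⟨i, δ⟩, h1, rfl⟩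
      have h2 := hr _ h1
      cases δ
      · left
        rw [vx_val hn (by simp; omega)]
        simpa using ⟨h2.2, h1⟩
      · right
        rw [vx_val hn (by simp; omega)]
        simpa using h1
  rw [e]
  refine h.map _ ?_ ?_
  · rintro ⟨i, δ⟩ hu ⟨i', δ'⟩ hu' h1
    have h2 := hr _ hu
    have h3 := hr _ hu'
    simp only at h2 h3
    rw [vx_inj hn (by split_ifs <;> omega) (by split_ifs <;> omega)] at h1
    rw [Prod.mk.injEq]
    cases δ <;> cases δ' <;> simp at h1 ⊢ <;> omega
  · rintro ⟨i, δ⟩ hu ⟨i', δ'⟩ hu'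
    have h2 := hr _ hu
    have h3 := hr _ hu'
    simp only at h2 h3
    rw [circ_adj hn, vx_val hn (by split_ifs <;> omega), vx_val hn (by split_ifs <;> omega),
      ladder_adj]
    cases δ <;> cases δ' <;> simp <;> omega

theorem circ_tr' (hn : 3 ≤ n) {d : ℕ}
    (h : Game ladder (lq 1 false n (fun δ => δ == false)) d)
    {R : Finset (Fin (2 * n))}
    (hR : ∀ v : Fin (2 * n), v ∈ R ↔ (v : ℕ) ≠ 0 ∧ (v : ℕ) ≠ n + 1) :
    Game (circulantGraph (2 * n) ({1, n} : Set ℕ)) R d := by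
  have hn2 : 2 ≤ n := by omega
  have hr : ∀ p ∈ lq 1 false n (fun δ => δ == false), (p.2 = false ∧ 1 ≤ p.1 ∧ p.1 ≤ n) ∨
      (p.2 = true ∧ 2 ≤ p.1 ∧ p.1 < n) := by
    rintro ⟨i, δ⟩ hp
    rw [mem_lq] at hp
    cases δ <;> simp at hp ⊢ <;> omega
  have e : R = (lq 1 false n (fun δ => δ == false)).image
      (fun p => vx n hn2 (p.1 + if p.2 = true then n else 0)) := by
    ext v
    have := v.2
    rw [hR, Finset.mem_image]
    constructor
    · intro h1
      by_cases h2 : (v : ℕ) ≤ n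
      · refine ⟨((v : ℕ), false), ?_, by rw [Fin.ext_iff, vx_val hn2 (by simp)]; simp⟩
        rw [mem_lq]; simp; omega
      · refine ⟨((v : ℕ) - n, true), ?_, by
          rw [Fin.ext_iff, vx_val hn2 (by simp; omega)]; simp; omega⟩
        rw [mem_lq]; simp; omega
    · rintro ⟨⟨i, δ⟩, h1, rfl⟩
      have h2 := hr _ h1
      cases δ
      · simp at h2
        rw [vx_val hn2 (by simp; omega)]
        simp
        omega
      · simp at h2
        rw [vx_val hn2 (by simp; omega)]
        simp
        omega
  rw [e]
  refine h.map _ ?_ ?_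
  · rintro ⟨i, δ⟩ hu ⟨i', δ'⟩ hu' h1
    have h2 := hr _ hu
    have h3 := hr _ hu'
    simp only at h2 h3
    rw [Prod.mk.injEq]
    cases δ <;> cases δ' <;> simp at h1 h2 h3 ⊢ <;>
      rw [vx_inj hn2 (by omega) (by omega)] at h1 <;> omega
  · rintro ⟨i, δ⟩ hu ⟨i', δ'⟩ hu'
    have h2 := hr _ hu
    have h3 := hr _ hu'
    simp only at h2 h3
    rw [circ_adj hn2, ladder_adj]
    cases δ <;> cases δ' <;> simp at h2 h3 ⊢ <;>
      rw [vx_val hn2 (by omega), vx_val hn2 (by omega)] <;> omega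

theorem link_zero (hn : 3 ≤ n) :
    Game (circulantGraph (2 * n) ({1, n} : Set ℕ)) ((Finset.univ : Finset (Fin (2 * n))).filter
      (fun u => ¬ (circulantGraph (2 * n) ({1, n} : Set ℕ)).Adj (vx n (by omega) 0) u))
      (2 * ((n - 3) / 4) + 3) := by
  have hn2 : 2 ≤ n := by omega
  have h := (lq_single (n - 3) 1 true).2
  rw [show 1 + (n - 3) + 1 = n - 1 by omega] at h
  have h2 := circ_tr hn2 (R := (Finset.univ : Finset (Fin (2 * n))).filter (fun v =>
    (v : ℕ) ≠ 0 ∧ (v : ℕ) ≠ 1 ∧ (v : ℕ) ≠ n ∧ (v : ℕ) ≠ 2 * n - 1)) h (by omega) (by omega)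
    (by omega) (by
      intro v
      have := v.2
      simp [mem_lq]
      omega)
  have h3 := h2.insert_isolated (t := vx n hn2 0) (by simp [vx_val hn2 (show 0 < 2 * n by omega)]) (by
    intro u hu
    have := u.2
    simp only [Finset.mem_filter] at hu
    rw [circ_adj hn2, vx_val hn2 (by omega)]
    omega)
  convert h3 using 1
  ext v
  have := v.2
  simp only [Finset.mem_filter, Finset.mem_insert, Finset.mem_univ, true_and, circ_adj hn2,
    vx_val hn2 (show 0 < 2 * n by omega), Fin.ext_iff]
  omega

theorem link_n (hn : 3 ≤ n) :
    Game (circulantGraph (2 * n) ({1, n} : Set ℕ))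
      (((Finset.univ : Finset (Fin (2 * n))).erase (vx n (by omega) 0)).filter
      (fun u => ¬ (circulantGraph (2 * n) ({1, n} : Set ℕ)).Adj (vx n (by omega) n) u))
      (2 * ((n - 3) / 4) + 3) := by
  have hn2 : 2 ≤ n := by omega
  have h := (lq_single (n - 3) 1 false).2
  rw [show 1 + (n - 3) + 1 = n - 1 by omega] at h
  have h2 := circ_tr hn2 (R := (Finset.univ : Finset (Fin (2 * n))).filter (fun v =>
    (v : ℕ) ≠ 0 ∧ (v : ℕ) ≠ n - 1 ∧ (v : ℕ) ≠ n ∧ (v : ℕ) ≠ n + 1)) h (by omega) (by omega)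
    (by omega) (by
      intro v
      have := v.2
      simp [mem_lq]
      omega)
  have h3 := h2.insert_isolated (t := vx n hn2 n) (by simp [vx_val hn2 (show n < 2 * n by omega)]) (by
    intro u hu
    have := u.2
    simp only [Finset.mem_filter] at hu
    rw [circ_adj hn2, vx_val hn2 (by omega)]
    omega)
  convert h3 using 1
  ext v
  have := v.2
  simp only [Finset.mem_filter, Finset.mem_insert, Finset.mem_univ, true_and, circ_adj hn2,
    vx_val hn2 (show 0 < 2 * n by omega), vx_val hn2 (show n < 2 * n by omega), Fin.ext_iff,
    Finset.mem_erase, ne_eq, and_true]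
  omega

theorem game_cut (hn : 3 ≤ n) :
    Game (circulantGraph (2 * n) ({1, n} : Set ℕ))
      (((Finset.univ : Finset (Fin (2 * n))).erase (vx n (by omega) 0)).erase (vx n (by omega) n))
      (n / 2) := by
  have hn2 : 2 ≤ n := by omega
  refine Game.step _ _ (vx n hn2 1) ?_ ?_ ?_
  · simp only [Finset.mem_univ, vx_val hn2 (show 0 < 2 * n by omega), vx_val hn2 (show n < 2 * n by omega), Fin.ext_iff,
      Finset.mem_erase, ne_eq, and_true, vx_val hn2 (show 1 < 2 * n by omega)]
    omega
  · have h := lq_full (n - 2) 1 true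
    rw [show 1 + (n - 2) = n - 1 by omega] at h
    refine circ_tr hn2 (h.mono (by omega)) (by omega) (by omega) (by omega) ?_
    intro v
    have := v.2
    simp only [Finset.mem_univ, vx_val hn2 (show 0 < 2 * n by omega), vx_val hn2 (show n < 2 * n by omega), Fin.ext_iff,
      Finset.mem_erase, ne_eq, and_true, vx_val hn2 (show 1 < 2 * n by omega)]
    simp [mem_lq]
    omega
  · have h := lq_full (n - 3) 2 true
    rw [show 2 + (n - 3) = n - 1 by omega] at h
    have h2 := circ_tr hn2 (R := (Finset.univ : Finset (Fin (2 * n))).filter (fun v =>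
      (v : ℕ) ≠ 0 ∧ (v : ℕ) ≠ 1 ∧ (v : ℕ) ≠ 2 ∧ (v : ℕ) ≠ n ∧ (v : ℕ) ≠ n + 1)) h (by omega) (by omega)
      (by omega) (by
        intro v
        have := v.2
        simp [mem_lq]
        omega)
    have h3 := h2.insert_isolated (t := vx n hn2 1) (by simp [vx_val hn2 (show 1 < 2 * n by omega)]) (by
      intro u hu
      have := u.2
      simp only [Finset.mem_filter] at hu
      rw [circ_adj hn2, vx_val hn2 (by omega)]
      omega)
    refine Game.mono (d := (n - 3) / 2 + 1 + 1) ?_ (by omega)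
    convert h3 using 1
    ext v
    have := v.2
    simp only [Finset.mem_filter, Finset.mem_insert, Finset.mem_univ, true_and, circ_adj hn2,
      vx_val hn2 (show 0 < 2 * n by omega), vx_val hn2 (show n < 2 * n by omega), Fin.ext_iff,
      Finset.mem_erase, ne_eq, and_true, vx_val hn2 (show 1 < 2 * n by omega)]
    omega

theorem game_one (hn : 3 ≤ n) {k : ℕ} (hk : n = 4 * k + 1) :
    Game (circulantGraph (2 * n) ({1, n} : Set ℕ))
      ((Finset.univ : Finset (Fin (2 * n))).erase (vx n (by omega) 0)) (2 * k + 1) := by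
  have hn2 : 2 ≤ n := by omega
  refine Game.step _ _ (vx n hn2 (n + 1)) ?_ ?_ ?_
  · simp only [Finset.mem_univ, vx_val hn2 (show 0 < 2 * n by omega), vx_val hn2 (show n + 1 < 2 * n by omega), Fin.ext_iff,
      Finset.mem_erase, ne_eq, and_true]
    omega
  · have h := (lq_single (n - 2) 1 false).1
    rw [show 1 + (n - 2) + 1 = n by omega] at h
    refine circ_tr' hn (h.mono (by omega)) ?_
    intro v
    simp only [Finset.mem_univ, vx_val hn2 (show 0 < 2 * n by omega), vx_val hn2 (show n + 1 < 2 * n by omega), Fin.ext_iff,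
      Finset.mem_erase, ne_eq, and_true]
    omega
  · have h := lq_full (n - 3) 2 false
    rw [show 2 + (n - 3) = n - 1 by omega] at h
    have h2 := circ_tr hn2 (R := (Finset.univ : Finset (Fin (2 * n))).filter (fun v =>
      (v : ℕ) ≠ 0 ∧ (v : ℕ) ≠ 1 ∧ (v : ℕ) ≠ n + 2 ∧ (v : ℕ) ≠ n ∧ (v : ℕ) ≠ n + 1)) h (by omega) (by omega)
      (by omega) (by
        intro v
        have := v.2
        simp [mem_lq]
        omega)
    have h3 := h2.insert_isolated (t := vx n hn2 (n + 1)) (by simp [vx_val hn2 (show n + 1 < 2 * n by omega)]) (by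
      intro u hu
      have := u.2
      simp only [Finset.mem_filter] at hu
      rw [circ_adj hn2, vx_val hn2 (by omega)]
      omega)
    refine Game.mono (d := (n - 3) / 2 + 1 + 1) ?_ (by omega)
    convert h3 using 1
    ext v
    have := v.2
    simp only [Finset.mem_filter, Finset.mem_insert, Finset.mem_univ, true_and, circ_adj hn2,
      vx_val hn2 (show 0 < 2 * n by omega), vx_val hn2 (show n + 1 < 2 * n by omega), Fin.ext_iff,
      Finset.mem_erase, ne_eq, and_true]
    omega

/-- The depth of the quotient by the edge ideal. -/
def dval (n : ℕ) : ℕ := if n % 4 = 1 then (n + 1) / 2 else n / 2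

theorem game_all (hn : 2 ≤ n) :
    Game (circulantGraph (2 * n) ({1, n} : Set ℕ)) (Finset.univ : Finset (Fin (2 * n)))
      (dval n) := by
  by_cases h3 : n = 2
  · subst h3
    exact Game.of_nonempty ⟨⟨0, by omega⟩, Finset.mem_univ _⟩
  have h4 : 3 ≤ n := by omega
  unfold dval
  refine Game.step _ _ (vx n hn 0) (Finset.mem_univ _) ?_ ((link_zero h4).mono (by split_ifs <;> omega))
  split_ifs with h1
  · exact (game_one h4 (k := n / 4) (by omega)).mono (by omega)
  · refine Game.step _ _ (vx n hn n) ?_ (game_cut h4) ((link_n h4).mono (by omega))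
    simp only [Finset.mem_univ, vx_val hn (show 0 < 2 * n by omega), vx_val hn (show n < 2 * n by omega), Fin.ext_iff,
      Finset.mem_erase, ne_eq, and_true]
    omega
end CircGame

theorem circ_lower {K : Type u} [Field K] {n q : ℕ} (hn : 2 ≤ n)
    (h : pdimLE (MvPolynomial (Fin (2 * n)) K) q (MvPolynomial (Fin (2 * n)) K ⧸
      srIdeal K (circulantGraph (2 * n) ({1, n} : Set ℕ)) Finset.univ)) :
    2 * n ≤ q + dval n := by
  classical
  unfold dval
  split_ifs with h1
  · have := socle_lower hn (k := n / 4) (by omega) h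
    omega
  by_cases h2 : n % 2 = 0
  · exact path_lower hn (o := 0) (by omega) (by omega) Finset.univ (by simp) h
  · have h3 : 3 ≤ n := by omega
    by_contra! hlt
    obtain ⟨p, hp1, hp⟩ : ∃ p, n / 2 + p + 2 = 2 * n ∧ q ≤ p + 1 :=
      ⟨2 * n - n / 2 - 2, by omega, by omega⟩
    have g0 := pdimLE_mono hp _ h
    have g1 := pdim_le_of_game (K := K) (link_zero h3) p (by rw [Fintype.card_fin]; omega)
    have g2 := pdim_le_of_game (K := K) (link_n h3) p (by rw [Fintype.card_fin]; omega)
    obtain ⟨f, g, e1, e2, e3⟩ := srIdeal_ses (K := K)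
      (G := circulantGraph (2 * n) ({1, n} : Set ℕ)) (Finset.mem_univ (vx n hn 0))
    have g3 := pdimLE_right e1 e2 e3 g1 g0
    have hm : vx n hn n ∈ (Finset.univ : Finset (Fin (2 * n))).erase (vx n hn 0) := by
      simp only [Finset.mem_univ, vx_val hn (show 0 < 2 * n by omega),
        vx_val hn (show n < 2 * n by omega), Fin.ext_iff, Finset.mem_erase, ne_eq, and_true]
      omega
    obtain ⟨f', g', e1', e2', e3'⟩ := srIdeal_ses (K := K)
      (G := circulantGraph (2 * n) ({1, n} : Set ℕ)) hm
    have g4 := pdimLE_right e1' e2' e3' g2 g3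
    have := path_lower hn (o := 1) (L := n / 2) (by omega) (by omega) _ (by
      intro v
      simp only [Finset.mem_univ, vx_val hn (show 0 < 2 * n by omega),
        vx_val hn (show n < 2 * n by omega), Fin.ext_iff, Finset.mem_erase, ne_eq, and_true, forall_const]
      exact and_comm) g4
    omega

theorem circ_pdim {K : Type u} [Field K] {n : ℕ} (hn : 2 ≤ n) :
    pdimQuot (edgeIdeal K (circulantGraph (2 * n) ({1, n} : Set ℕ))) = 2 * n - dval n := by
  classical
  unfold pdimQuot
  rw [edgeIdeal_eq_srIdeal]
  refine IsLeast.csInf_eq ⟨?_, ?_⟩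
  · refine pdim_le_of_game (game_all hn) _ ?_
    rw [Fintype.card_fin]
    omega
  · intro q hq
    have := circ_lower hn hq
    omega

theorem pdim_circulant_one (n : ℕ) (hn : 2 ≤ n) (K : Type*) [Field K] :
    (n % 4 = 1 → pdimQuot (edgeIdeal K (circulantGraph (2 * n) ({1, n} : Set ℕ))) = 2 * n - ⌈(n : ℚ) / 2⌉₊) ∧
    (n % 4 ≠ 1 → pdimQuot (edgeIdeal K (circulantGraph (2 * n) ({1, n} : Set ℕ))) = 2 * n - ⌈((n : ℚ) - 1) / 2⌉₊) := by
  rw [circ_pdim hn]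
  constructor
  · intro h
    have e : ⌈(n : ℚ) / 2⌉₊ = dval n := by
      unfold dval
      rw [if_pos h]
      obtain ⟨k, hk⟩ : ∃ k, n = 2 * k + 1 := ⟨n / 2, by omega⟩
      rw [Nat.ceil_eq_iff (by omega), show (n + 1) / 2 = k + 1 by omega]
      subst hk
      push_cast
      constructor
      · linarith
      · linarith
    rw [e]
  · intro h
    have e : ⌈((n : ℚ) - 1) / 2⌉₊ = dval n := by
      unfold dval
      rw [if_neg h, Nat.ceil_eq_iff (by omega)]
      rcases Nat.even_or_odd' n with ⟨k, hk | hk⟩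
      · rw [show n / 2 = k by omega]
        subst hk
        rw [Nat.cast_sub (by omega)]
        push_cast
        constructor <;> linarith
      · rw [show n / 2 = k by omega]
        subst hk
        rw [Nat.cast_sub (by omega)]
        push_cast
        constructor <;> linarith
    rw [e]
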